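/- Let ψ₁,…,ψ_m be quadratic Pfister forms over a field F that are all k-linked (they share a common k-fold quadratic Pfister factor). Define inductively F^m_k(ψ₁,…,ψ_m) = F²_k(F^{m−1}_k(ψ₁,…,ψ_{m−1}), ψ_m), where F²_k(ψ, ψ') = φ ⊗ φ' ⊗ π for any presentation ψ ≅ φ ⊗ π, ψ' ≅ φ' ⊗ π with π a k-fold quadratic Pfister form and φ, φ' bilinear Pfister forms. Then F^{m−1}_k(ψ₁,…,ψ_{m−1}) is a quadratic Pfister form that is k-linked to ψ_m, so the definition makes sense, and F^m_k(ψ₁,…,ψ_m) is well-defined up to isometry, independent of all choices. -/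

import Mathlib

noncomputable section

open QuadraticMap

/-- A quadratic form over `F` on the space `F^d`, bundled together with its dimension `d`. -/
structure QF (F : Type) [Field F] where
  dim : ℕ
  form : QuadraticForm F (Fin dim → F)

namespace QF

variable {F : Type} [Field F]

/-- Isometry of bundled quadratic forms. -/
def Equiv (q q' : QF F) : Prop := QuadraticMap.Equivalent q.form q'.form

/-- The standard linear equivalence `F^(a+b) ≃ F^a × F^b`. -/
def finSplit (F : Type) [Field F] (a b : ℕ) :
    (Fin (a + b) → F) ≃ₗ[F] (Fin a → F) × (Fin b → F) :=
  (LinearEquiv.funCongrLeft F F finSumFinEquiv).trans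
    (LinearEquiv.sumArrowLequivProdArrow _ _ F F)

/-- Orthogonal sum of bundled quadratic forms. -/
def sum (q₁ q₂ : QF F) : QF F :=
  ⟨q₁.dim + q₂.dim, (q₁.form.prod q₂.form).comp (finSplit F q₁.dim q₂.dim).toLinearMap⟩

instance : Neg (QF F) := ⟨fun q => ⟨q.dim, -q.form⟩⟩

instance : SMul F (QF F) := ⟨fun a q => ⟨q.dim, a • q.form⟩⟩

/-- `⟨⟨γ⟩⟩ ⊗ q = q ⊥ (−γ)·q` : twisting a quadratic form by the
1-fold bilinear Pfister form `⟨⟨γ⟩⟩ = ⟨1, −γ⟩`. -/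
def twist (γ : F) (q : QF F) : QF F := q.sum ((-γ) • q)

/-- `⟨⟨γ₁,…,γ_m⟩⟩ ⊗ q` : tensoring a quadratic form with the `m`-fold bilinear
Pfister form whose slots are the entries of the list `l = [γ₁,…,γ_m]`. -/
def btensor (l : List F) (q : QF F) : QF F := l.foldr twist q

/-- The zero form on the zero space. -/
def zero (F : Type) [Field F] : QF F := ⟨0, 0⟩

/-- The one-dimensional form `⟨1⟩`, `x ↦ x²`. -/
def unit (F : Type) [Field F] : QF F := ⟨1, QuadraticMap.sq.comp (LinearMap.proj 0)⟩

/-- The binary quadratic form `[1,α] : (x,y) ↦ x² + xy + αy²`. -/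
def binary (α : F) : QF F := ⟨2, (Matrix.of ![![1, 1], ![0, α]]).toQuadraticMap'⟩

/-- The hyperbolic plane `ℍ : (x,y) ↦ xy`. -/
def hyp (F : Type) [Field F] : QF F := ⟨2, (Matrix.of ![![0, 1], ![0, 0]]).toQuadraticMap'⟩

/-- `m × ℍ`, the orthogonal sum of `m` hyperbolic planes. -/
def hyps (F : Type) [Field F] : ℕ → QF F
  | 0 => zero F
  | n + 1 => (hyp F).sum (hyps F n)

/-- A quadratic form is isotropic if it represents `0` nontrivially. -/
def Isotropic (q : QF F) : Prop := ∃ v, q.form v = 0 ∧ v ≠ 0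

/-- A quadratic form is hyperbolic if it is isometric to an orthogonal
sum of hyperbolic planes. -/
def Hyperbolic (q : QF F) : Prop := ∃ m, q.Equiv (hyps F m)

/-- All entries of the list are nonzero (the slots of a bilinear Pfister form
must be units). -/
def UnitList (l : List F) : Prop := ∀ γ ∈ l, γ ≠ 0

/-- `q` is an `n`-fold quadratic Pfister form.  In characteristic `2` this means
`q ≅ ⟨⟨γ₁,…,γ_{n−1}, α]] = ⟨⟨γ₁,…,γ_{n−1}⟩⟩ ⊗ [1,α]`; in characteristic `≠ 2` it means
`q ≅ ⟨⟨γ₁,…,γ_n⟩⟩ = ⟨1,−γ₁⟩ ⊗ ⋯ ⊗ ⟨1,−γ_n⟩`. -/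
def IsQPfister (n : ℕ) (q : QF F) : Prop :=
  if ringChar F = 2 then
    ∃ (l : List F) (α : F), UnitList l ∧ l.length + 1 = n ∧ (btensor l (binary α)).Equiv q
  else
    ∃ l : List F, UnitList l ∧ l.length = n ∧ (btensor l (unit F)).Equiv q

/-- `φ` is a `k`-fold quadratic Pfister factor of `ψ`, i.e. `ψ ≅ B ⊗ φ` for some
bilinear Pfister form `B`. -/
def IsQPfisterFactor (k : ℕ) (φ ψ : QF F) : Prop :=
  IsQPfister k φ ∧ ∃ l : List F, UnitList l ∧ (btensor l φ).Equiv ψ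

/-- A finite family of quadratic Pfister forms is (separably) `k`-linked if its members
share a common `k`-fold quadratic Pfister factor. -/
def SepLinked (k : ℕ) (ψs : List (QF F)) : Prop :=
  ∃ π : QF F, IsQPfister k π ∧
    ∀ ψ ∈ ψs, ∃ l : List F, UnitList l ∧ (btensor l π).Equiv ψ

/-- A finite family of quadratic Pfister forms is inseparably `k`-linked if its members
share a common `k`-fold bilinear Pfister factor. -/
def InsepLinked (k : ℕ) (ψs : List (QF F)) : Prop :=
  ∃ l : List F, UnitList l ∧ l.length = k ∧
    ∀ ψ ∈ ψs, ∃ (n : ℕ) (π : QF F), IsQPfister n π ∧ (btensor l π).Equiv ψ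

/-- `q` is the value of the two-form invariant `F²_k(ψ₁, ψ₂) = φ₁ ⊗ φ₂ ⊗ π`
for some presentation `ψ₁ ≅ φ₁ ⊗ π`, `ψ₂ ≅ φ₂ ⊗ π`. -/
def IsPairInv (k : ℕ) (ψ₁ ψ₂ q : QF F) : Prop :=
  ∃ (π : QF F) (l₁ l₂ : List F), IsQPfister k π ∧ UnitList l₁ ∧ UnitList l₂ ∧
    (btensor l₁ π).Equiv ψ₁ ∧ (btensor l₂ π).Equiv ψ₂ ∧
    q.Equiv (btensor l₁ (btensor l₂ π))

/-- `IsInv k ψs q` : `q` is a value of the inductively defined invariant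
`F^m_k(ψ₁,…,ψ_m)`, where `F¹_k(ψ) = ψ` and
`F^m_k(ψ₁,…,ψ_m) = F²_k(F^{m−1}_k(ψ₁,…,ψ_{m−1}), ψ_m)`. -/
inductive IsInv (k : ℕ) : List (QF F) → QF F → Prop
  | single (ψ : QF F) : IsInv k [ψ] ψ
  | step {ψs : List (QF F)} {ψ q' q : QF F} :
      IsInv k ψs q' → IsPairInv k q' ψ q → IsInv k (ψs ++ [ψ]) q

end QF
namespace QF

variable {F : Type} [Field F]

/-- The (upper triangular) Gram-type matrix of a bundled quadratic form:
`q(∑ xᵢ eᵢ) = ∑ᵢ q(eᵢ) xᵢ² + ∑_{i<j} polar(eᵢ,eⱼ) xᵢ xⱼ`. -/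
def matrixOf (q : QF F) : Matrix (Fin q.dim) (Fin q.dim) F := fun i j =>
  if i = j then q.form (Pi.single i 1)
  else if i < j then polar q.form (Pi.single i 1) (Pi.single j 1)
  else 0

/-- Base change (extension of scalars) of a bundled quadratic form along a
ring homomorphism of fields. -/
def baseChange {E : Type} [Field E] (σ : F →+* E) (q : QF F) : QF E :=
  ⟨q.dim, (q.matrixOf.map σ).toQuadraticMap'⟩

/-- The homogeneous degree-2 polynomial cut out by a bundled quadratic form. -/
def toPoly (q : QF F) : MvPolynomial (Fin q.dim) F :=
  ∑ i, ∑ j, MvPolynomial.C (q.matrixOf i j) * (MvPolynomial.X i * MvPolynomial.X j)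

/-- The affine coordinate ring of the quadric `q = 0`. -/
def coordRing (q : QF F) : Type :=
  MvPolynomial (Fin q.dim) F ⧸ Ideal.span {q.toPoly}

instance (q : QF F) : CommRing q.coordRing := Ideal.Quotient.commRing _
instance (q : QF F) : Algebra F q.coordRing := Ideal.Quotient.algebra F

/-- The function field `F(q)` of the quadric `q = 0` (assuming the coordinate
ring is a domain). -/
def funField (q : QF F) : Type := FractionRing q.coordRing

instance (q : QF F) : CommRing q.funField := by unfold funField; infer_instance

noncomputable instance (q : QF F) [IsDomain q.coordRing] : Field q.funField := by
  unfold funField; infer_instance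

/-- The canonical embedding `F → F(q)`. -/
noncomputable def toFunField (q : QF F) : F →+* q.funField :=
  (algebraMap q.coordRing (FractionRing q.coordRing)).comp (algebraMap F q.coordRing)

/-- `⟨⟨γ₁,…,γ_m⟩⟩′ ⊗ q` : the tensor product with `q` of the pure part of the
bilinear Pfister form with slots `γ₁,…,γ_m`, so that
`⟨⟨l⟩⟩ ⊗ q ≅ q ⊥ (⟨⟨l⟩⟩′ ⊗ q)`. -/
def bpure : List F → QF F → QF F
  | [], _ => zero F
  | γ :: l, q => (bpure l q).sum ((-γ) • btensor l q)

end QF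

namespace QF

section Modules

variable {F V W : Type*} [Field F] [AddCommGroup V] [Module F V] [AddCommGroup W] [Module F W]

/-- A quadratic map whose polar form has trivial radical. -/
def PolarNondeg (Q : QuadraticForm F V) : Prop := ∀ v, (∀ w, polar Q v w = 0) → v = 0

theorem equivalent_of_linearMap [FiniteDimensional F V] [FiniteDimensional F W]
    {Q : QuadraticForm F V} {Q' : QuadraticForm F W} (hQ : PolarNondeg Q)
    (hdim : Module.finrank F V = Module.finrank F W) (f : V →ₗ[F] W)
    (hf : ∀ v, Q' (f v) = Q v) : QuadraticMap.Equivalent Q Q' := by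
  have hinj : Function.Injective f := by
    rw [injective_iff_map_eq_zero]
    intro v hv
    refine hQ v fun w => ?_
    rw [polar, ← hf, ← hf, ← hf, map_add, hv]
    simp
  exact ⟨⟨LinearEquiv.ofInjectiveOfFinrankEq f hinj hdim, hf⟩⟩

theorem PolarNondeg.equivalent {Q : QuadraticForm F V} {Q' : QuadraticForm F W}
    (hQ : PolarNondeg Q) (h : QuadraticMap.Equivalent Q Q') : PolarNondeg Q' := by
  obtain ⟨e⟩ := h
  intro v hv
  have : e.symm v = 0 := by
    refine hQ _ fun w => ?_
    have := hv (e w)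
    simp only [polar] at this ⊢
    rw [← e.map_app, ← e.map_app (e.symm v), ← e.map_app w, map_add]
    simpa using this
  simpa using this

theorem polarNondeg_prod {Q : QuadraticForm F V} {Q' : QuadraticForm F W} :
    PolarNondeg (Q.prod Q') ↔ PolarNondeg Q ∧ PolarNondeg Q' := by
  constructor
  · intro h
    refine ⟨fun v hv => ?_, fun v hv => ?_⟩
    · have := h (v, 0) fun w => by simp [hv]
      simpa using this
    · have := h (0, v) fun w => by simp [hv]
      simpa using this
  · rintro ⟨h, h'⟩ ⟨v, w⟩ hv
    refine Prod.ext (h v fun x => ?_) (h' w fun x => ?_)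
    · simpa using hv (x, 0)
    · simpa using hv (0, x)

/-- A hyperbolic pair `(e, f)` of the quadratic form `Q`. -/
structure HypPair (Q : QuadraticForm F V) (e f : V) : Prop where
  left : Q e = 0
  right : Q f = 0
  polar_eq : polar Q e f = 1

theorem HypPair.symm {Q : QuadraticForm F V} {e f : V} (h : HypPair Q e f) : HypPair Q f e :=
  ⟨h.right, h.left, by rw [polar_comm, h.polar_eq]⟩

/-- The orthogonal complement of a pair of vectors. -/
def pairCompl (Q : QuadraticForm F V) (e f : V) : Submodule F V :=
  LinearMap.ker (Q.polarBilin e) ⊓ LinearMap.ker (Q.polarBilin f)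

theorem mem_pairCompl {Q : QuadraticForm F V} {e f v : V} :
    v ∈ pairCompl Q e f ↔ polar Q e v = 0 ∧ polar Q f v = 0 := by
  simp [pairCompl]

/-- The restriction of a quadratic form to the complement of a pair of vectors. -/
def complForm (Q : QuadraticForm F V) (e f : V) : QuadraticForm F (pairCompl Q e f) :=
  Q.comp (pairCompl Q e f).subtype

/-- The projection of the complement of `(e, f)` to the complement of `(e, f')`. -/
def complProj {Q : QuadraticForm F V} {e f f' : V} (h' : HypPair Q e f') :
    pairCompl Q e f →ₗ[F] pairCompl Q e f' where
  toFun x := ⟨x - polar Q f' x • e, by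
    have hx := (mem_pairCompl.1 x.2).1
    have he : polar Q e e = 0 := by rw [polar_self, h'.left, smul_zero]
    rw [mem_pairCompl, polar_sub_right, polar_sub_right, polar_smul_right, polar_smul_right,
      hx, he, h'.symm.polar_eq]
    simp⟩
  map_add' x y := by
    ext
    simp only [Submodule.coe_add, polar_add_right, add_smul]
    abel
  map_smul' a x := by
    ext
    simp only [Submodule.coe_smul, polar_smul_right, smul_sub, smul_assoc, RingHom.id_apply]

theorem complProj_complProj {Q : QuadraticForm F V} {e f f' : V} (h : HypPair Q e f)
    (h' : HypPair Q e f') (x : pairCompl Q e f) :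
    complProj h (complProj h' x : pairCompl Q e f') = x := by
  ext
  have hx := (mem_pairCompl.1 x.2).2
  simp [complProj, polar_sub_right, polar_smul_right, hx, h.symm.polar_eq]

theorem complForm_equivalent_of_left {Q : QuadraticForm F V} {e f f' : V} (h : HypPair Q e f)
    (h' : HypPair Q e f') :
    QuadraticMap.Equivalent (complForm Q e f) (complForm Q e f') := by
  refine ⟨⟨⟨complProj h', complProj h, complProj_complProj h h', complProj_complProj h' h⟩,
    fun x => ?_⟩⟩
  have hx := (mem_pairCompl.1 x.2).1
  have key : ∀ a : F, Q (x - a • e) = Q x := fun a => by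
    have := polar_smul_right Q (-a) (x : V) e
    rw [polar_comm Q _ e, hx, polar, Q.map_smul, h'.left] at this
    rw [sub_eq_add_neg, ← neg_smul]
    simpa [sub_eq_zero] using this
  exact key _

theorem complForm_equivalent {Q : QuadraticForm F V} {e f e' f' : V} (h : HypPair Q e f)
    (h' : HypPair Q e' f') :
    QuadraticMap.Equivalent (complForm Q e f) (complForm Q e' f') := by
  have hyp_smul : ∀ {u v : V}, Q u = 0 → Q v = 0 → ∀ hc : polar Q u v ≠ 0,
      HypPair Q u ((polar Q u v)⁻¹ • v) := fun hu hv hc =>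
    ⟨hu, by rw [Q.map_smul, hv, smul_zero], by
      rw [polar_smul_right, smul_eq_mul, inv_mul_cancel₀ hc]⟩
  have smul_hyp : ∀ {u v : V}, Q u = 0 → Q v = 0 → ∀ hc : polar Q u v ≠ 0,
      HypPair Q ((polar Q u v)⁻¹ • u) v := fun hu hv hc =>
    ⟨by rw [Q.map_smul, hu, smul_zero], hv, by
      rw [polar_smul_left, smul_eq_mul, inv_mul_cancel₀ hc]⟩
  have key : ∀ {u v u' v' : V}, HypPair Q u v → HypPair Q u' v' → polar Q u u' ≠ 0 →
      QuadraticMap.Equivalent (complForm Q u v) (complForm Q u' v') := by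
    intro u v u' v' huv huv' hc
    have h₁ := hyp_smul huv.left huv'.left hc
    have hc' : polar Q u' u ≠ 0 := by rwa [polar_comm]
    have h₂ := hyp_smul huv'.left huv.left hc'
    have h₃ : QuadraticMap.Equivalent (complForm Q u ((polar Q u u')⁻¹ • u'))
        (complForm Q u' ((polar Q u' u)⁻¹ • u)) := by
      have : pairCompl Q u ((polar Q u u')⁻¹ • u') = pairCompl Q u' ((polar Q u' u)⁻¹ • u) := by
        ext x
        simp [mem_pairCompl, polar_smul_left, hc, hc', and_comm]
      exact ⟨⟨LinearEquiv.ofEq _ _ this, fun _ => rfl⟩⟩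
    exact ((complForm_equivalent_of_left huv h₁).trans h₃).trans
      (complForm_equivalent_of_left h₂ huv')
  have inter : ∀ {g g' : V}, HypPair Q g g' → polar Q e g ≠ 0 → polar Q g e' ≠ 0 →
      QuadraticMap.Equivalent (complForm Q e f) (complForm Q e' f') := fun hg h₁ h₂ =>
    (key h hg h₁).trans (key hg h' h₂)
  by_cases h₀ : polar Q e e' = 0
  swap
  · exact key h h' h₀
  by_cases h₁ : polar Q f e' = 0
  swap
  · exact inter h.symm (by simp [h.polar_eq]) h₁
  by_cases h₂ : polar Q e f' = 0
  swap
  · exact inter h'.symm h₂ (by simp [h'.symm.polar_eq])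
  have hee : polar Q e e = 0 := by rw [polar_self, h.left, smul_zero]
  have he₁ : polar Q e (f + f' - polar Q f f' • e) = 1 := by
    simp [polar_add_right, polar_sub_right, polar_smul_right, hee, h₂, h.polar_eq]
  have he₂ : polar Q (f + f' - polar Q f f' • e) e' = 1 := by
    simp [polar_add_left, polar_sub_left, polar_smul_left, h₀, h₁, h'.symm.polar_eq]
  have hq : Q (f + f' - polar Q f f' • e) = 0 := by
    have e₁ := polar_smul_right Q (-polar Q f f') (f + f') e
    rw [polar_comm Q _ e, polar_add_right, h.polar_eq, h₂, polar, Q.map_smul, h.left] at e₁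
    have e₂ : Q (f + f') = polar Q f f' := by rw [polar, h.right, h'.right]; ring
    rw [sub_eq_add_neg, ← neg_smul]
    simp only [smul_eq_mul] at e₁
    linear_combination e₁ + e₂
  exact inter (g := f + f' - polar Q f f' • e) (g' := e)
    ⟨hq, h.left, by rw [polar_comm]; exact he₁⟩ (by simp [he₁]) (by simp [he₂])

end Modules

section Hyperbolic

variable {F : Type} [Field F]

/-- The hyperbolic plane, as a form on `Fin 2 → F`. -/
def hypForm (F : Type) [Field F] : QuadraticForm F (Fin 2 → F) := (hyp F).form

/-- The form `[1,α]`, as a form on `Fin 2 → F`. -/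
def binaryForm (α : F) : QuadraticForm F (Fin 2 → F) := (binary α).form

/-- The form `⟨1⟩`, as a form on `Fin 1 → F`. -/
def unitForm (F : Type) [Field F] : QuadraticForm F (Fin 1 → F) := (unit F).form

theorem hypForm_apply (v : Fin 2 → F) : hypForm F v = v 0 * v 1 := by
  change (Matrix.of ![![0, 1], ![0, 0]]).toQuadraticForm' v = _
  simp [Matrix.toQuadraticForm', Matrix.toLinearMap₂'_apply, Fin.sum_univ_two]

theorem binaryForm_apply (α : F) (v : Fin 2 → F) :
    binaryForm α v = v 0 * v 0 + v 0 * v 1 + α * (v 1 * v 1) := by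
  change (Matrix.of ![![1, 1], ![0, α]]).toQuadraticForm' v = _
  simp [Matrix.toQuadraticForm', Matrix.toLinearMap₂'_apply, Fin.sum_univ_two]
  ring

theorem unitForm_apply (v : Fin 1 → F) : unitForm F v = v 0 * v 0 := rfl

variable {V W : Type*} [AddCommGroup V] [Module F V] [AddCommGroup W] [Module F W]

theorem HypPair.map {Q : QuadraticForm F V} {Q' : QuadraticForm F W} {e f : V}
    (h : HypPair Q e f) (g : Q.IsometryEquiv Q') : HypPair Q' (g e) (g f) := by
  refine ⟨by rw [g.map_app, h.left], by rw [g.map_app, h.right], ?_⟩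
  rw [← h.polar_eq, polar, polar, ← map_add, g.map_app, g.map_app, g.map_app]

theorem complForm_map {Q : QuadraticForm F V} {Q' : QuadraticForm F W} (e f : V)
    (g : Q.IsometryEquiv Q') :
    QuadraticMap.Equivalent (complForm Q e f) (complForm Q' (g e) (g f)) := by
  have hp : ∀ x y, polar Q' (g x) (g y) = polar Q x y := fun x y => by
    rw [polar, polar, ← map_add, g.map_app, g.map_app, g.map_app]
  refine ⟨⟨g.toLinearEquiv.submoduleMap (pairCompl Q e f) |>.trans (LinearEquiv.ofEq _ _ ?_),
    fun x => g.map_app x⟩⟩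
  ext x
  obtain ⟨y, rfl⟩ := g.toLinearEquiv.surjective x
  rw [Submodule.mem_map_equiv, LinearEquiv.symm_apply_apply, mem_pairCompl, mem_pairCompl]
  change _ ↔ polar Q' (g e) (g y) = 0 ∧ polar Q' (g f) (g y) = 0
  rw [hp, hp]

theorem hypPair_hyp_prod (Q : QuadraticForm F V) :
    HypPair ((hypForm F).prod Q) (![1, 0], 0) (![0, 1], 0) := by
  constructor <;> simp [polar, hypForm_apply]

theorem complForm_hyp_prod (Q : QuadraticForm F V) :
    QuadraticMap.Equivalent Q (complForm ((hypForm F).prod Q) (![1, 0], 0) (![0, 1], 0)) := by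
  have hmem : ∀ x : (Fin 2 → F) × V,
      x ∈ pairCompl ((hypForm F).prod Q) (![1, 0], 0) (![0, 1], 0) ↔ x.1 = 0 := by
    intro x
    have h0 : polar (hypForm F) ![1, 0] x.1 = x.1 1 := by
      rw [polar, hypForm_apply, hypForm_apply, hypForm_apply]
      simp
      ring
    have h1 : polar (hypForm F) ![0, 1] x.1 = x.1 0 := by
      rw [polar, hypForm_apply, hypForm_apply, hypForm_apply]
      simp
      ring
    rw [mem_pairCompl, polar_prod, polar_prod, h0, h1]
    constructor
    · rintro ⟨h, h'⟩
      funext i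
      fin_cases i
      · simpa using h'
      · simpa using h
    · intro h
      simp [h]
  refine ⟨⟨LinearEquiv.ofBijective
    (LinearMap.codRestrict _ (LinearMap.inr F (Fin 2 → F) V) fun v => (hmem _).2 rfl) ⟨?_, ?_⟩,
    fun v => ?_⟩⟩
  · intro v w h
    simpa using congrArg (fun x => x.1.2) h
  · intro x
    refine ⟨x.1.2, Subtype.ext (Prod.ext ?_ rfl)⟩
    exact ((hmem _).1 x.2).symm
  · change ((hypForm F).prod Q) (0, v) = Q v
    simp

/-- Witt cancellation of a hyperbolic plane. -/
theorem equivalent_of_hyp_prod {Q : QuadraticForm F V} {Q' : QuadraticForm F W}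
    (h : QuadraticMap.Equivalent ((hypForm F).prod Q) ((hypForm F).prod Q')) :
    QuadraticMap.Equivalent Q Q' := by
  obtain ⟨g⟩ := h
  exact (((complForm_hyp_prod Q).trans (complForm_map _ _ g)).trans
    (complForm_equivalent ((hypPair_hyp_prod Q).map g) (hypPair_hyp_prod Q'))).trans
    (complForm_hyp_prod Q').symm

theorem prod_equivalent_of_subsingleton_left [Subsingleton V] (P : QuadraticForm F V)
    (Q : QuadraticForm F W) : QuadraticMap.Equivalent (P.prod Q) Q :=
  ⟨⟨LinearEquiv.ofBijective (LinearMap.snd F V W)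
    ⟨fun _ _ h => Prod.ext (Subsingleton.elim _ _) h, fun w => ⟨(0, w), rfl⟩⟩, fun v => by
      change Q v.2 = P v.1 + Q v.2
      rw [Subsingleton.elim v.1 0, P.map_zero, zero_add]⟩⟩

end Hyperbolic

section Classes

variable {F : Type} [Field F]

theorem form_sum_equivalent (p q : QF F) :
    QuadraticMap.Equivalent (p.sum q).form (p.form.prod q.form) :=
  ⟨⟨finSplit F p.dim q.dim, fun _ => rfl⟩⟩

/-- Isometry as a setoid. -/
def isometrySetoid (F : Type) [Field F] : Setoid (QF F) :=
  ⟨QF.Equiv, fun q => QuadraticMap.Equivalent.refl q.form, fun h => QuadraticMap.Equivalent.symm h,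
    fun h h' => QuadraticMap.Equivalent.trans h h'⟩

/-- Isometry classes of quadratic forms. -/
def Cls (F : Type) [Field F] : Type := Quotient (isometrySetoid F)

/-- The isometry class of a quadratic form. -/
def cls (q : QF F) : Cls F := Quotient.mk (isometrySetoid F) q

theorem cls_eq_iff {p q : QF F} : cls p = cls q ↔ p.Equiv q :=
  Quotient.eq (r := isometrySetoid F)

theorem exists_cls (x : Cls F) : ∃ q, cls q = x := Quotient.exists_rep x

theorem smul_form_equivalent {V W : Type*} [AddCommGroup V] [Module F V] [AddCommGroup W]
    [Module F W] {Q : QuadraticForm F V} {Q' : QuadraticForm F W}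
    (h : QuadraticMap.Equivalent Q Q') (a : F) : QuadraticMap.Equivalent (a • Q) (a • Q') := by
  obtain ⟨g⟩ := h
  exact ⟨⟨g.toLinearEquiv, fun v => congrArg (a • ·) (g.map_app v)⟩⟩

instance : Add (Cls F) :=
  ⟨Quotient.map₂ QF.sum fun _ _ h _ _ h' =>
    ((form_sum_equivalent _ _).trans (h.prod h')).trans (form_sum_equivalent _ _).symm⟩

instance : Zero (Cls F) := ⟨cls (zero F)⟩

instance : SMul F (Cls F) := ⟨fun a => Quotient.map (a • ·) fun _ _ h => smul_form_equivalent h a⟩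

theorem cls_sum (p q : QF F) : cls (p.sum q) = cls p + cls q := rfl

theorem cls_smul (a : F) (q : QF F) : cls (a • q) = a • cls q := rfl

theorem cls_zero : cls (zero F) = 0 := rfl

theorem cls_add_eq_cls_add {p q r s : QF F}
    (h : QuadraticMap.Equivalent (p.form.prod q.form) (r.form.prod s.form)) :
    cls p + cls q = cls r + cls s := by
  rw [← cls_sum, ← cls_sum, cls_eq_iff]
  exact ((form_sum_equivalent _ _).trans h).trans (form_sum_equivalent _ _).symm

theorem cls_eq_cls_add {p r s : QF F}
    (h : QuadraticMap.Equivalent p.form (r.form.prod s.form)) : cls p = cls r + cls s := by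
  rw [← cls_sum, cls_eq_iff]
  exact h.trans (form_sum_equivalent _ _).symm

theorem prod_assoc_equivalent {U V W : Type*} [AddCommGroup U] [Module F U] [AddCommGroup V]
    [Module F V] [AddCommGroup W] [Module F W] (P : QuadraticForm F U) (Q : QuadraticForm F V)
    (R : QuadraticForm F W) :
    QuadraticMap.Equivalent ((P.prod Q).prod R) (P.prod (Q.prod R)) :=
  ⟨⟨LinearEquiv.prodAssoc F U V W, fun v => by simp [add_assoc]⟩⟩

theorem Cls.add_comm (x y : Cls F) : x + y = y + x := by
  obtain ⟨⟨p, rfl⟩, ⟨q, rfl⟩⟩ := And.intro (exists_cls x) (exists_cls y)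
  exact cls_add_eq_cls_add ⟨QuadraticMap.IsometryEquiv.prodComm _ _⟩

theorem Cls.zero_add (x : Cls F) : 0 + x = x := by
  obtain ⟨p, rfl⟩ := exists_cls x
  have : Subsingleton (Fin (zero F).dim → F) := inferInstanceAs (Subsingleton (Fin 0 → F))
  exact (cls_eq_cls_add (prod_equivalent_of_subsingleton_left (zero F).form p.form).symm).symm

theorem sum_assoc_equiv (p q r : QF F) : ((p.sum q).sum r).Equiv (p.sum (q.sum r)) :=
  have h₁ : QuadraticMap.Equivalent ((p.sum q).form.prod r.form)
      ((p.form.prod q.form).prod r.form) :=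
    (form_sum_equivalent p q).prod (QuadraticMap.Equivalent.refl r.form)
  have h₂ : QuadraticMap.Equivalent (p.form.prod (q.sum r).form)
      (p.form.prod (q.form.prod r.form)) :=
    (QuadraticMap.Equivalent.refl p.form).prod (form_sum_equivalent q r)
  (((form_sum_equivalent (p.sum q) r).trans h₁).trans
    (prod_assoc_equivalent p.form q.form r.form)).trans
    (h₂.symm.trans (form_sum_equivalent p (q.sum r)).symm)

theorem Cls.add_assoc (x y z : Cls F) : x + y + z = x + (y + z) := by
  obtain ⟨⟨p, rfl⟩, ⟨q, rfl⟩, ⟨r, rfl⟩⟩ :=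
    And.intro (exists_cls x) (And.intro (exists_cls y) (exists_cls z))
  rw [← cls_sum p q, ← cls_sum q r, ← cls_sum (p.sum q) r, ← cls_sum p (q.sum r)]
  exact cls_eq_iff.2 (sum_assoc_equiv p q r)

instance : AddCommMonoid (Cls F) where
  add_assoc := Cls.add_assoc
  zero_add x := Cls.zero_add x
  add_zero x := by rw [Cls.add_comm, Cls.zero_add]
  add_comm := Cls.add_comm
  nsmul := nsmulRec

instance : DistribMulAction F (Cls F) where
  one_smul x := by
    obtain ⟨p, rfl⟩ := exists_cls x
    rw [← cls_smul, cls_eq_iff]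
    exact ⟨⟨LinearEquiv.refl _ _, fun v => (one_mul (p.form v)).symm⟩⟩
  mul_smul a b x := by
    obtain ⟨p, rfl⟩ := exists_cls x
    rw [← cls_smul, ← cls_smul, ← cls_smul, cls_eq_iff]
    exact ⟨⟨LinearEquiv.refl _ _, fun v => (mul_assoc a b (p.form v)).symm⟩⟩
  smul_zero a := by
    rw [← cls_zero, ← cls_smul, cls_eq_iff]
    exact ⟨⟨LinearEquiv.refl _ _, fun v => (mul_zero a).symm⟩⟩
  smul_add a x y := by
    obtain ⟨⟨p, rfl⟩, ⟨q, rfl⟩⟩ := And.intro (exists_cls x) (exists_cls y)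
    rw [← cls_sum, ← cls_smul, ← cls_smul, ← cls_smul]
    refine cls_eq_cls_add ⟨⟨finSplit F p.dim q.dim, fun v => ?_⟩⟩
    exact (mul_add a _ _).symm

/-- The class of the hyperbolic plane. -/
def hypCls (F : Type) [Field F] : Cls F := cls (hyp F)

theorem hypCls_add_cancel {x y : Cls F} (h : hypCls F + x = hypCls F + y) : x = y := by
  obtain ⟨⟨p, rfl⟩, ⟨q, rfl⟩⟩ := And.intro (exists_cls x) (exists_cls y)
  rw [hypCls, ← cls_sum, ← cls_sum, cls_eq_iff] at h
  rw [cls_eq_iff]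
  exact equivalent_of_hyp_prod
    (((form_sum_equivalent _ _).symm.trans h).trans (form_sum_equivalent _ _))

theorem nsmul_hypCls_add_cancel {x y : Cls F} (n : ℕ)
    (h : n • hypCls F + x = n • hypCls F + y) : x = y := by
  induction n with
  | zero => simpa using h
  | succ n ih =>
    refine ih (hypCls_add_cancel ?_)
    rw [← add_assoc, ← add_assoc, ← succ_nsmul']
    exact h

end Classes

section Predicates

variable {F : Type} [Field F]

/-- The dimension of an isometry class. -/
def Cls.dim : Cls F → ℕ :=
  Quotient.lift QF.dim fun p q h => by
    obtain ⟨e⟩ := h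
    simpa using e.toLinearEquiv.finrank_eq

theorem dim_cls (q : QF F) : (cls q).dim = q.dim := rfl

theorem dim_add (x y : Cls F) : (x + y).dim = x.dim + y.dim := by
  obtain ⟨⟨p, rfl⟩, ⟨q, rfl⟩⟩ := And.intro (exists_cls x) (exists_cls y)
  rfl

theorem dim_smul (a : F) (x : Cls F) : (a • x).dim = x.dim := by
  obtain ⟨p, rfl⟩ := exists_cls x
  rfl

/-- The class `x` represents `c` (nontrivially unless `c = 0`). -/
def Rep (x : Cls F) (c : F) : Prop := ∃ q, cls q = x ∧ ∃ v, q.form v = c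

/-- The class `x` is isotropic. -/
def Isot (x : Cls F) : Prop := ∃ q, cls q = x ∧ q.Isotropic

/-- The class `x` has a nondegenerate polar form. -/
def NS (x : Cls F) : Prop := ∃ q, cls q = x ∧ PolarNondeg q.form

theorem rep_cls {q : QF F} {c : F} : Rep (cls q) c ↔ ∃ v, q.form v = c := by
  refine ⟨fun ⟨p, hp, v, hv⟩ => ?_, fun h => ⟨q, rfl, h⟩⟩
  obtain ⟨e⟩ := cls_eq_iff.1 hp
  exact ⟨e v, (e.map_app v).trans hv⟩

theorem isot_cls {q : QF F} : Isot (cls q) ↔ q.Isotropic := by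
  refine ⟨fun ⟨p, hp, v, hv, h0⟩ => ?_, fun h => ⟨q, rfl, h⟩⟩
  obtain ⟨e⟩ := cls_eq_iff.1 hp
  exact ⟨e v, (e.map_app v).trans hv, fun h => h0 (e.toLinearEquiv.map_eq_zero_iff.1 h)⟩

theorem ns_cls {q : QF F} : NS (cls q) ↔ PolarNondeg q.form :=
  ⟨fun ⟨_, hp, h⟩ => h.equivalent (cls_eq_iff.1 hp), fun h => ⟨q, rfl, h⟩⟩

theorem rep_add {x y : Cls F} {c : F} : Rep (x + y) c ↔ ∃ a b, Rep x a ∧ Rep y b ∧ a + b = c := by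
  obtain ⟨⟨p, rfl⟩, ⟨q, rfl⟩⟩ := And.intro (exists_cls x) (exists_cls y)
  rw [← cls_sum, rep_cls]
  constructor
  · rintro ⟨v, rfl⟩
    exact ⟨_, _, rep_cls.2 ⟨(finSplit F p.dim q.dim v).1, rfl⟩,
      rep_cls.2 ⟨(finSplit F p.dim q.dim v).2, rfl⟩, rfl⟩
  · rintro ⟨a, b, ha, hb, rfl⟩
    obtain ⟨v, rfl⟩ := rep_cls.1 ha
    obtain ⟨w, rfl⟩ := rep_cls.1 hb
    refine ⟨(finSplit F p.dim q.dim).symm (v, w), ?_⟩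
    change (p.form.prod q.form) (finSplit F p.dim q.dim ((finSplit F p.dim q.dim).symm (v, w))) = _
    rw [LinearEquiv.apply_symm_apply]
    rfl

theorem rep_zero (x : Cls F) : Rep x 0 := by
  obtain ⟨p, rfl⟩ := exists_cls x
  exact rep_cls.2 ⟨0, p.form.map_zero⟩

theorem rep_smul {x : Cls F} {a c : F} : Rep (a • x) c ↔ ∃ d, Rep x d ∧ a * d = c := by
  obtain ⟨p, rfl⟩ := exists_cls x
  rw [← cls_smul, rep_cls]
  constructor
  · rintro ⟨v, rfl⟩
    exact ⟨_, rep_cls.2 ⟨v, rfl⟩, rfl⟩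
  · rintro ⟨d, hd, rfl⟩
    obtain ⟨v, rfl⟩ := rep_cls.1 hd
    exact ⟨v, rfl⟩

theorem Rep.sq_mul {x : Cls F} {c : F} (h : Rep x c) (a : F) : Rep x (a * a * c) := by
  obtain ⟨p, rfl⟩ := exists_cls x
  obtain ⟨v, rfl⟩ := rep_cls.1 h
  exact rep_cls.2 ⟨a • v, by rw [p.form.map_smul, smul_eq_mul]⟩

theorem eq_zero_of_rep_zero_cls {c : F} (h : Rep (0 : Cls F) c) : c = 0 := by
  obtain ⟨v, rfl⟩ := rep_cls.1 h
  rfl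

theorem Isot.cases {x y : Cls F} (h : Isot (x + y)) :
    (∃ c, c ≠ 0 ∧ Rep x c ∧ Rep y (-c)) ∨ Isot x ∨ Isot y := by
  obtain ⟨⟨p, rfl⟩, ⟨q, rfl⟩⟩ := And.intro (exists_cls x) (exists_cls y)
  rw [← cls_sum] at h
  obtain ⟨v, hv, h0⟩ := isot_cls.1 h
  have hv' : p.form (finSplit F p.dim q.dim v).1 + q.form (finSplit F p.dim q.dim v).2 = 0 := hv
  by_cases hc : p.form (finSplit F p.dim q.dim v).1 = 0
  · right
    rw [hc, zero_add] at hv'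
    by_cases h1 : (finSplit F p.dim q.dim v).1 = 0
    · right
      refine isot_cls.2 ⟨_, hv', fun h2 => h0 ?_⟩
      exact (finSplit F p.dim q.dim).map_eq_zero_iff.1 (Prod.ext h1 h2)
    · exact Or.inl (isot_cls.2 ⟨_, hc, h1⟩)
  · left
    exact ⟨_, hc, rep_cls.2 ⟨_, rfl⟩, rep_cls.2 ⟨_, eq_neg_of_add_eq_zero_right hv'⟩⟩

theorem Isot.of_smul {x : Cls F} {a : F} (ha : a ≠ 0) (h : Isot (a • x)) : Isot x := by
  obtain ⟨p, rfl⟩ := exists_cls x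
  obtain ⟨v, hv, h0⟩ := isot_cls.1 ((cls_smul a p).symm ▸ h)
  exact isot_cls.2 ⟨v, (mul_eq_zero.1 (show a * p.form v = 0 from hv)).resolve_left ha, h0⟩

theorem Isot.add_right {x : Cls F} (h : Isot x) (y : Cls F) : Isot (x + y) := by
  obtain ⟨⟨p, rfl⟩, ⟨q, rfl⟩⟩ := And.intro (exists_cls x) (exists_cls y)
  obtain ⟨v, hv, h0⟩ := isot_cls.1 h
  rw [← cls_sum]
  refine isot_cls.2 ⟨(finSplit F p.dim q.dim).symm (v, 0), ?_, fun h2 => h0 ?_⟩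
  · change (p.form.prod q.form) (finSplit F p.dim q.dim ((finSplit F p.dim q.dim).symm (v, 0))) = _
    rw [LinearEquiv.apply_symm_apply, QuadraticMap.prod_apply, hv, q.form.map_zero, add_zero]
  · exact congrArg Prod.fst ((finSplit F p.dim q.dim).symm.map_eq_zero_iff.1 h2)

theorem isot_hypCls : Isot (hypCls F) :=
  isot_cls.2 ⟨(![1, 0] : Fin 2 → F), (hypForm_apply _).trans (by simp), fun h => by
    exact one_ne_zero (congrFun h (0 : Fin 2))⟩

theorem ns_add {x y : Cls F} : NS (x + y) ↔ NS x ∧ NS y := by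
  obtain ⟨⟨p, rfl⟩, ⟨q, rfl⟩⟩ := And.intro (exists_cls x) (exists_cls y)
  rw [← cls_sum, ns_cls, ns_cls, ns_cls, ← polarNondeg_prod]
  exact ⟨fun h => h.equivalent (form_sum_equivalent p q),
    fun h => h.equivalent (form_sum_equivalent p q).symm⟩

theorem NS.smul {x : Cls F} (h : NS x) {a : F} (ha : a ≠ 0) : NS (a • x) := by
  obtain ⟨p, rfl⟩ := exists_cls x
  rw [← cls_smul]
  rw [ns_cls] at h ⊢
  intro v hv
  refine h v fun w => ?_
  have : a * (p.form (v + w) - p.form v - p.form w) = 0 := by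
    rw [mul_sub, mul_sub]
    exact hv w
  exact (mul_eq_zero.1 this).resolve_left ha

/-- A nondegenerate isotropic form is universal. -/
theorem Isot.rep {x : Cls F} (h : Isot x) (hx : NS x) (c : F) : Rep x c := by
  obtain ⟨p, rfl⟩ := exists_cls x
  obtain ⟨v, hv, h0⟩ := isot_cls.1 h
  obtain ⟨w, hw⟩ : ∃ w, polar p.form v w ≠ 0 := by
    by_contra! hw
    exact h0 (ns_cls.1 hx v hw)
  refine rep_cls.2 ⟨w + ((c - p.form w) / polar p.form v w) • v, ?_⟩
  have := polar_smul_right p.form ((c - p.form w) / polar p.form v w) w v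
  rw [polar_comm p.form w v, smul_eq_mul, div_mul_cancel₀ _ hw, polar, p.form.map_smul, hv,
    smul_zero] at this
  linear_combination this

theorem mul_self_smul {c : F} (hc : c ≠ 0) (x : Cls F) : (c * c) • x = x := by
  obtain ⟨p, rfl⟩ := exists_cls x
  rw [← cls_smul, cls_eq_iff]
  refine ⟨⟨LinearEquiv.smulOfNeZero F _ c hc, fun v => ?_⟩⟩
  exact p.form.map_smul c v

theorem smul_add_smul_same {a b : F} (hab : a + b ≠ 0) (x : Cls F) :
    a • x + b • x = (a + b) • x + (a * b * (a + b)) • x := by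
  obtain ⟨p, rfl⟩ := exists_cls x
  rw [← cls_smul, ← cls_smul, ← cls_smul, ← cls_smul]
  refine (cls_add_eq_cls_add (QuadraticMap.Equivalent.symm ?_))
  let f : (Fin p.dim → F) × (Fin p.dim → F) →ₗ[F] (Fin p.dim → F) × (Fin p.dim → F) :=
    (LinearMap.fst F _ _ + b • LinearMap.snd F _ _).prod
      (LinearMap.fst F _ _ - a • LinearMap.snd F _ _)
  let g : (Fin p.dim → F) × (Fin p.dim → F) →ₗ[F] (Fin p.dim → F) × (Fin p.dim → F) :=
    LinearMap.prod ((a + b)⁻¹ • (a • LinearMap.fst F _ _ + b • LinearMap.snd F _ _))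
      ((a + b)⁻¹ • (LinearMap.fst F _ _ - LinearMap.snd F _ _))
  have hfg : f ∘ₗ g = LinearMap.id := by
    refine LinearMap.ext fun v => Prod.ext (funext fun i => ?_) (funext fun i => ?_)
    · change (a + b)⁻¹ * (a * v.1 i + b * v.2 i) + b * ((a + b)⁻¹ * (v.1 i - v.2 i)) = v.1 i
      field_simp
      ring
    · change (a + b)⁻¹ * (a * v.1 i + b * v.2 i) - a * ((a + b)⁻¹ * (v.1 i - v.2 i)) = v.2 i
      field_simp
      ring
  refine ⟨⟨LinearEquiv.ofLinearMap f g hfg ((LinearMap.comp_eq_id_comm F _).1 hfg), fun v => ?_⟩⟩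
  change a * p.form (v.1 + b • v.2) + b * p.form (v.1 - a • v.2) =
    (a + b) * p.form v.1 + a * b * (a + b) * p.form v.2
  have h₁ := polar_smul_right p.form b v.1 v.2
  have h₂ := polar_smul_right p.form (-a) v.1 v.2
  rw [polar, p.form.map_smul, smul_eq_mul, smul_eq_mul] at h₁ h₂
  rw [sub_eq_add_neg, ← neg_smul]
  linear_combination a * h₁ + b * h₂

theorem cls_hyps (n : ℕ) : cls (hyps F n) = n • hypCls F := by
  induction n with
  | zero => rfl
  | succ n ih => rw [succ_nsmul', ← ih]; rfl

theorem dim_hyps (n : ℕ) : (hyps F n).dim = n + n := by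
  induction n with
  | zero => rfl
  | succ n ih =>
    change 2 + (hyps F n).dim = _
    omega

theorem exists_linearMap_hyps {W : Type*} [AddCommGroup W] [Module F W] (n : ℕ)
    (a b : Fin n → W →ₗ[F] F) :
    ∃ g : W →ₗ[F] (Fin (hyps F n).dim → F), ∀ w, (hyps F n).form (g w) = ∑ i, a i w * b i w := by
  induction n with
  | zero => exact ⟨0, fun w => by simp⟩
  | succ n ih =>
    obtain ⟨g, hg⟩ := ih (fun i => a i.succ) fun i => b i.succ
    refine ⟨(finSplit F 2 (hyps F n).dim).symm.toLinearMap ∘ₗ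
      (LinearMap.pi ![a 0, b 0]).prod g, fun w => ?_⟩
    change ((hypForm F).prod (hyps F n).form) (finSplit F 2 (hyps F n).dim
      ((finSplit F 2 (hyps F n).dim).symm (LinearMap.pi ![a 0, b 0] w, g w))) = _
    rw [LinearEquiv.apply_symm_apply, QuadraticMap.prod_apply, hypForm_apply, hg,
      Fin.sum_univ_succ]
    rfl

theorem NS.add_neg {x : Cls F} (h : NS x) : x + (-1 : F) • x = x.dim • hypCls F := by
  have h' : NS (x + (-1 : F) • x) := ns_add.2 ⟨h, h.smul (by simp)⟩
  obtain ⟨p, rfl⟩ := exists_cls x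
  obtain ⟨B, hB⟩ := LinearMap.BilinMap.toQuadraticMap_surjective p.form
  rw [← cls_hyps, dim_cls]
  rw [← cls_smul, ← cls_sum] at h' ⊢
  rw [cls_eq_iff]
  have hB' : ∀ v, p.form v = B v v := fun v => by rw [← hB]; rfl
  obtain ⟨g, hg⟩ := exists_linearMap_hyps (W := (Fin p.dim → F) × (Fin p.dim → F)) p.dim
    (fun i => LinearMap.proj i ∘ₗ (LinearMap.fst F _ _ - LinearMap.snd F _ _))
    (fun i => B (Pi.single i 1) ∘ₗ LinearMap.fst F _ _ +
      B.flip (Pi.single i 1) ∘ₗ LinearMap.snd F _ _)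
  refine (form_sum_equivalent _ _).trans (equivalent_of_linearMap
    ((ns_cls.1 h').equivalent (form_sum_equivalent _ _)) ?_ g ?_)
  · rw [Module.finrank_prod, Module.finrank_fin_fun, Module.finrank_fin_fun,
      Module.finrank_fin_fun, dim_hyps]
    rfl
  · rintro ⟨v, w⟩
    rw [hg]
    change _ = p.form v + -1 * p.form w
    have h₁ : ∀ z, ∑ i, z i * B (Pi.single i 1) v = B z v := fun z => by
      conv_rhs => rw [pi_eq_sum_univ' z]
      simp
    have h₂ : ∀ z, ∑ i, z i * B w (Pi.single i 1) = B w z := fun z => by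
      conv_rhs => rw [pi_eq_sum_univ' z]
      simp
    have h₃ : ∑ i, (v - w) i * (B (Pi.single i 1) v + B w (Pi.single i 1)) =
        B (v - w) v + B w (v - w) := by
      rw [← h₁, ← h₂, ← Finset.sum_add_distrib]
      exact Finset.sum_congr rfl fun i _ => mul_add _ _ _
    refine h₃.trans ?_
    rw [hB', hB', map_sub, map_sub, LinearMap.sub_apply]
    ring

theorem add_right_cancel_of_ns {x y z : Cls F} (hz : NS z) (h : x + z = y + z) : x = y := by
  refine nsmul_hypCls_add_cancel z.dim ?_
  rw [← hz.add_neg, add_comm, add_comm _ y, ← add_assoc, ← add_assoc, h]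

end Predicates

section Twists

variable {F : Type} [Field F]

/-- The class-level version of `QF.twist`. -/
def tw (γ : F) (x : Cls F) : Cls F := x + (-γ) • x

/-- The class-level version of `QF.btensor`. -/
def bt (l : List F) (x : Cls F) : Cls F := l.foldr tw x

/-- The class-level version of `QF.bpure`. -/
def bp : List F → Cls F → Cls F
  | [], _ => 0
  | γ :: l, x => bp l x + (-γ) • bt l x

theorem cls_btensor (l : List F) (q : QF F) : cls (btensor l q) = bt l (cls q) := by
  induction l with
  | nil => rfl
  | cons γ l ih => exact congrArg (tw γ) ih

theorem bt_cons (γ : F) (l : List F) (x : Cls F) : bt (γ :: l) x = tw γ (bt l x) := rfl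

theorem bp_cons (γ : F) (l : List F) (x : Cls F) :
    bp (γ :: l) x = bp l x + (-γ) • bt l x := rfl

theorem bt_append (l₁ l₂ : List F) (x : Cls F) : bt (l₁ ++ l₂) x = bt l₁ (bt l₂ x) :=
  List.foldr_append

theorem tw_comm (a b : F) (x : Cls F) : tw a (tw b x) = tw b (tw a x) := by
  simp only [tw, smul_add, smul_smul, mul_comm (-b) (-a)]
  abel

theorem bt_tw (l : List F) (a : F) (x : Cls F) : bt l (tw a x) = tw a (bt l x) := by
  induction l with
  | nil => rfl
  | cons γ l ih => rw [bt_cons, bt_cons, ih, tw_comm]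

theorem bt_comm (l₁ l₂ : List F) (x : Cls F) : bt l₁ (bt l₂ x) = bt l₂ (bt l₁ x) := by
  induction l₁ with
  | nil => rfl
  | cons γ l ih => rw [bt_cons, bt_cons, ih, bt_tw]

theorem bt_eq_add_bp (l : List F) (x : Cls F) : bt l x = x + bp l x := by
  induction l with
  | nil => exact (add_zero x).symm
  | cons γ l ih =>
    rw [bt_cons, bp_cons, tw, ← add_assoc, ← ih]

theorem dim_tw (γ : F) (x : Cls F) : (tw γ x).dim = 2 * x.dim := by
  rw [tw, dim_add, dim_smul, two_mul]

theorem dim_bt (l : List F) (x : Cls F) : (bt l x).dim = 2 ^ l.length * x.dim := by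
  induction l with
  | nil => simp [bt]
  | cons γ l ih => rw [bt_cons, dim_tw, ih, List.length_cons, pow_succ']; ring

theorem unitList_cons {γ : F} {l : List F} : UnitList (γ :: l) ↔ γ ≠ 0 ∧ UnitList l :=
  List.forall_mem_cons

theorem unitList_nil : UnitList ([] : List F) := fun _ h => absurd h List.not_mem_nil

theorem unitList_append {l₁ l₂ : List F} (h₁ : UnitList l₁) (h₂ : UnitList l₂) :
    UnitList (l₁ ++ l₂) := fun γ h => (List.mem_append.1 h).elim (h₁ γ) (h₂ γ)

/-- The form classes that behave like quadratic Pfister forms: they are nondegenerate, represent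
`1`, and every represented unit is a similarity factor. -/
structure Pf (x : Cls F) : Prop where
  ns : NS x
  rep_one : Rep x 1
  smul_eq : ∀ c, c ≠ 0 → Rep x c → c • x = x

theorem Pf.dim_pos {x : Cls F} (h : Pf x) : 0 < x.dim := by
  obtain ⟨p, rfl⟩ := exists_cls x
  obtain ⟨v, hv⟩ := rep_cls.1 h.rep_one
  refine Nat.pos_of_ne_zero fun h0 => ?_
  have : IsEmpty (Fin p.dim) := by
    rw [show p.dim = 0 from h0]
    infer_instance
  rw [Subsingleton.elim v 0, p.form.map_zero] at hv
  exact zero_ne_one hv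

theorem Pf.tw {x : Cls F} (h : Pf x) {γ : F} (hγ : γ ≠ 0) : Pf (tw γ x) := by
  refine ⟨ns_add.2 ⟨h.ns, h.ns.smul (neg_ne_zero.2 hγ)⟩,
    rep_add.2 ⟨1, 0, h.rep_one, rep_zero _, add_zero 1⟩, fun c hc hrep => ?_⟩
  obtain ⟨s, r, hs, hr, rfl⟩ := rep_add.1 hrep
  obtain ⟨t, ht, rfl⟩ := rep_smul.1 hr
  have hst : ∀ {a}, a ≠ 0 → Rep x a → ∀ b : F, (a * b) • x = b • x := fun ha hra b => by
    rw [mul_comm, mul_smul, h.smul_eq _ ha hra]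
  by_cases ht0 : t = 0
  · subst ht0
    rw [mul_zero, add_zero] at hc ⊢
    rw [QF.tw, smul_add, smul_smul, hst hc hs, h.smul_eq s hc hs]
  by_cases hs0 : s = 0
  · subst hs0
    rw [zero_add, QF.tw, smul_add, smul_smul, mul_comm (-γ) t, hst ht0 ht, mul_assoc,
      hst ht0 ht, neg_mul_neg, mul_self_smul hγ, add_comm]
  · have h₁ := smul_add_smul_same hc x
    rw [h.smul_eq s hs0 hs, mul_comm (-γ) t, hst ht0 ht] at h₁
    rw [QF.tw, smul_add, h₁, smul_smul, mul_assoc s, hst hs0 hs, mul_assoc t, hst ht0 ht,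
      mul_comm (-γ) (_ + _), mul_comm (-γ) t]

theorem Pf.bt {x : Cls F} (h : Pf x) {l : List F} (hl : UnitList l) : Pf (bt l x) := by
  induction l with
  | nil => exact h
  | cons γ l ih => exact (ih (unitList_cons.1 hl).2).tw (unitList_cons.1 hl).1

theorem Pf.ns_bp {x : Cls F} (h : Pf x) {l : List F} (hl : UnitList l) : NS (bp l x) := by
  have := (h.bt hl).ns
  rw [bt_eq_add_bp] at this
  exact (ns_add.1 this).2

theorem Pf.tw_mul {x : Cls F} (h : Pf x) {c : F} (hc : c ≠ 0) (hr : Rep x c) (γ : F) :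
    QF.tw (γ * c) x = QF.tw γ x := by
  rw [QF.tw, QF.tw, ← neg_mul, mul_smul, h.smul_eq c hc hr]

theorem Pf.eq_of_smul_eq {x y : Cls F} (hx : Pf x) (hy : Pf y) {a b : F} (ha : a ≠ 0)
    (h : a • x = b • y) : x = y := by
  have h₁ : x = (a⁻¹ * b) • y := by rw [mul_smul, ← h, smul_smul, inv_mul_cancel₀ ha, one_smul]
  have h₂ := hx.rep_one
  rw [h₁] at h₂
  obtain ⟨d, hd, hd'⟩ := rep_smul.1 h₂
  have hd0 : d ≠ 0 := right_ne_zero_of_mul_eq_one hd'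
  rw [h₁, ← hy.smul_eq d hd0 hd, smul_smul, hd', one_smul, hy.smul_eq d hd0 hd]

theorem tw_tw {a b : F} (hab : a + b ≠ 0) (x : Cls F) :
    tw a (tw b x) = tw (a + b) (tw (-(a * b)) x) := by
  have h := smul_add_smul_same (a := -a) (b := -b)
    (by rw [← neg_add]; exact neg_ne_zero.2 hab) x
  simp only [tw, smul_add, smul_smul, neg_neg, neg_mul_neg]
  calc x + (-b) • x + ((-a) • x + (a * b) • x) = x + (a * b) • x + ((-a) • x + (-b) • x) := by abel
    _ = _ := by
      rw [h, ← neg_add, neg_mul_neg, mul_comm (a * b)]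

/-- The pure subform theorem. -/
theorem Pf.exists_cons {A : Cls F} (hA : Pf A) {l : List F} (hl : UnitList l) {c : F} (hc : c ≠ 0)
    (h : Rep (bp l A) (-c)) :
    ∃ l', UnitList l' ∧ l'.length + 1 = l.length ∧ QF.bt l A = QF.bt (c :: l') A := by
  induction l generalizing c with
  | nil => exact absurd (neg_eq_zero.1 (eq_zero_of_rep_zero_cls h)) hc
  | cons γ m ih =>
    obtain ⟨hγ, hm⟩ := unitList_cons.1 hl
    obtain ⟨p, r, hp, hr, hpr⟩ := rep_add.1 h
    obtain ⟨t, ht, rfl⟩ := rep_smul.1 hr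
    by_cases ht0 : t = 0
    · rw [ht0, mul_zero, add_zero] at hpr
      obtain ⟨m', hm', hlen, e⟩ := ih hm hc (hpr ▸ hp)
      refine ⟨γ :: m', unitList_cons.2 ⟨hγ, hm'⟩, by simp [hlen], ?_⟩
      rw [bt_cons, e, bt_cons, bt_cons, bt_cons, tw_comm]
    by_cases hp0 : p = 0
    · have hcγ : c = γ * t := by linear_combination hpr - hp0
      refine ⟨m, hm, rfl, ?_⟩
      rw [hcγ, bt_cons, bt_cons, (hA.bt hm).tw_mul ht0 ht]
    · obtain ⟨m', hm', hlen, e⟩ := ih (c := -p) hm (neg_ne_zero.2 hp0) (by rwa [neg_neg])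
      have hcγ : c = γ * t + -p := by linear_combination hpr
      refine ⟨-(γ * t * -p) :: m', unitList_cons.2
        ⟨neg_ne_zero.2 (mul_ne_zero (mul_ne_zero hγ ht0) (neg_ne_zero.2 hp0)), hm'⟩,
        by simp [hlen], ?_⟩
      rw [bt_cons, ← (hA.bt hm).tw_mul ht0 ht, e, bt_cons, bt_cons, bt_cons,
        tw_tw (hcγ ▸ hc), hcγ]

theorem Pf.tw_tw_eq {x y : Cls F} (hx : Pf x) (hy : Pf y) {b d b' d' : F} (hb : b ≠ 0) (hd : d ≠ 0)
    (hb' : b' ≠ 0) (hd' : d' ≠ 0) (e₁ : QF.tw b x = QF.tw b' y) (e₂ : QF.tw d x = QF.tw d' y) :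
    QF.tw b (QF.tw d x) = QF.tw b' (QF.tw d' y) := by
  have key : ∀ {z : Cls F}, Pf z → ∀ {b d : F}, b ≠ 0 → QF.tw b z + (-1 : F) • QF.tw d z =
      z.dim • hypCls F + (-b) • QF.tw (b * d) z := by
    intro z hz b d hb
    have h₁ : (-b) • QF.tw (b * d) z = (-b) • z + d • z := by
      rw [QF.tw, smul_add, smul_smul, neg_mul_neg, ← mul_assoc, mul_comm (b * b), mul_smul,
        mul_self_smul hb]
    rw [h₁, ← hz.ns.add_neg, QF.tw, QF.tw, smul_add, smul_smul, neg_mul_neg, one_mul]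
    abel
  have hdim : x.dim = y.dim := by
    have := congrArg Cls.dim e₁
    rw [dim_tw, dim_tw] at this
    omega
  have h₁ : (-b) • QF.tw (b * d) x = (-b') • QF.tw (b' * d') y := by
    refine nsmul_hypCls_add_cancel x.dim ?_
    rw [← key hx hb, e₁, e₂, key hy hb', hdim]
  have hM : QF.tw (b * d) x = QF.tw (b' * d') y :=
    (hx.tw (mul_ne_zero hb hd)).eq_of_smul_eq (hy.tw (mul_ne_zero hb' hd'))
      (neg_ne_zero.2 hb) h₁
  have hneg : ∀ (z : Cls F) {b : F}, b ≠ 0 → (-b) • QF.tw b z = QF.tw b z := by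
    intro z b hb
    rw [QF.tw, smul_add, smul_smul, neg_mul_neg, mul_self_smul hb, add_comm]
  have hP : (-(b * d)) • QF.tw b x = (-(b' * d')) • QF.tw b x := by
    refine add_right_cancel_of_ns (hx.tw hb).ns ?_
    rw [add_comm, add_comm _ (QF.tw b x)]
    change QF.tw (b * d) (QF.tw b x) = QF.tw (b' * d') (QF.tw b x)
    rw [tw_comm, QF.tw, h₁, hM, e₁, tw_comm (b' * d')]
    rfl
  have h₂ : (b * d) • QF.tw b x = (b' * d') • QF.tw b x := by
    have := congrArg ((-1 : F) • ·) hP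
    simpa only [smul_smul, neg_mul_neg, one_mul] using this
  have h₃ : (-d) • QF.tw b x = (-d') • QF.tw b x := by
    calc (-d) • QF.tw b x = (-d) • (-b) • QF.tw b x := by rw [hneg x hb]
      _ = (b * d) • QF.tw b x := by rw [smul_smul, neg_mul_neg, mul_comm]
      _ = (b' * d') • QF.tw b' y := by rw [h₂, e₁]
      _ = (-d') • (-b') • QF.tw b' y := by rw [smul_smul, neg_mul_neg, mul_comm]
      _ = (-d') • QF.tw b x := by rw [hneg y hb', e₁]
  rw [tw_comm, QF.tw, h₃, e₁, tw_comm b']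
  rfl

theorem isot_nsmul_add {n : ℕ} (hn : 0 < n) (z : Cls F) : Isot (n • hypCls F + z) := by
  obtain ⟨n, rfl⟩ := Nat.exists_eq_succ_of_ne_zero hn.ne'
  rw [succ_nsmul', add_assoc]
  exact isot_hypCls.add_right _

theorem Pf.exists_rep_bp {B : Cls F} (hB : Pf B) {κ : List F} (hκ : UnitList κ)
    (h0 : κ ≠ []) : ∃ c, c ≠ 0 ∧ Rep (bp κ B) c := by
  obtain ⟨γ, m, rfl⟩ := List.exists_cons_of_ne_nil h0
  obtain ⟨hγ, hm⟩ := unitList_cons.1 hκ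
  exact ⟨-γ, neg_ne_zero.2 hγ, rep_add.2 ⟨0, -γ, rep_zero _,
    rep_smul.2 ⟨1, (hB.bt hm).rep_one, mul_one _⟩, zero_add _⟩⟩

/-- Two Pfister multiples of `B` whose difference has Witt index larger than `dim B` have a further
common slot. -/
theorem Pf.exists_common_slot {B z : Cls F} (hB : Pf B) {κ₁ κ₂ : List F} (h₁ : UnitList κ₁)
    (h₂ : UnitList κ₂) (hne₁ : κ₁ ≠ []) (hne₂ : κ₂ ≠ []) {n : ℕ} (hn : B.dim < n)
    (h : QF.bt κ₁ B + (-1 : F) • QF.bt κ₂ B = n • hypCls F + z) :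
    ∃ x κ₁' κ₂', x ≠ 0 ∧ UnitList κ₁' ∧ UnitList κ₂' ∧ κ₁'.length + 1 = κ₁.length ∧
      κ₂'.length + 1 = κ₂.length ∧ QF.bt κ₁ B = QF.bt (x :: κ₁') B ∧
      QF.bt κ₂ B = QF.bt (x :: κ₂') B := by
  have hiso : Isot (bp κ₁ B + (-1 : F) • bp κ₂ B) := by
    have : bp κ₁ B + (-1 : F) • bp κ₂ B = (n - B.dim) • hypCls F + z := by
      refine nsmul_hypCls_add_cancel B.dim ?_
      rw [← add_assoc _ _ z, ← add_nsmul, Nat.add_sub_cancel' hn.le, ← h, ← hB.ns.add_neg,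
        bt_eq_add_bp, bt_eq_add_bp, smul_add]
      abel
    rw [this]
    exact isot_nsmul_add (Nat.sub_pos_of_lt hn) z
  obtain ⟨c, hc, hr₁, hr₂⟩ : ∃ c, c ≠ 0 ∧ Rep (bp κ₁ B) c ∧ Rep (bp κ₂ B) c := by
    rcases hiso.cases with ⟨c, hc, hr₁, hr₂⟩ | h' | h'
    · obtain ⟨d, hd, hd'⟩ := rep_smul.1 hr₂
      have : d = c := by linear_combination -hd'
      exact ⟨c, hc, hr₁, this ▸ hd⟩
    · obtain ⟨c, hc, hr⟩ := hB.exists_rep_bp h₂ hne₂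
      exact ⟨c, hc, h'.rep (hB.ns_bp h₁) c, hr⟩
    · obtain ⟨c, hc, hr⟩ := hB.exists_rep_bp h₁ hne₁
      exact ⟨c, hc, hr, (h'.of_smul (neg_ne_zero.2 one_ne_zero)).rep (hB.ns_bp h₂) c⟩
  obtain ⟨κ₁', u₁, len₁, e₁⟩ := hB.exists_cons h₁ (neg_ne_zero.2 hc) (by rwa [neg_neg])
  obtain ⟨κ₂', u₂, len₂, e₂⟩ := hB.exists_cons h₂ (neg_ne_zero.2 hc) (by rwa [neg_neg])
  exact ⟨-c, κ₁', κ₂', neg_ne_zero.2 hc, u₁, u₂, len₁, len₂, e₁, e₂⟩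

/-- Two Pfister multiples of `B` with a common half share all slots but one. -/
theorem Pf.exists_linkage {m : ℕ} {B x : Cls F} (hB : Pf B) (hx : Pf x)
    (hdim : x.dim = 2 ^ m * B.dim) {κ₁ κ₂ : List F} (h₁ : UnitList κ₁)
    (h₂ : UnitList κ₂) (len₁ : κ₁.length = m + 1) (len₂ : κ₂.length = m + 1) {t₁ t₂ : F}
    (e₁ : QF.tw t₁ x = QF.bt κ₁ B) (e₂ : QF.tw t₂ x = QF.bt κ₂ B) :
    ∃ σ p r, UnitList σ ∧ σ.length = m ∧ p ≠ 0 ∧ r ≠ 0 ∧ QF.tw t₁ x = QF.tw p (QF.bt σ B) ∧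
      QF.tw t₂ x = QF.tw r (QF.bt σ B) := by
  induction m generalizing B κ₁ κ₂ with
  | zero =>
    obtain ⟨p, rfl⟩ := List.length_eq_one_iff.1 len₁
    obtain ⟨r, rfl⟩ := List.length_eq_one_iff.1 len₂
    exact ⟨[], p, r, unitList_nil, rfl, (unitList_cons.1 h₁).1, (unitList_cons.1 h₂).1, e₁, e₂⟩
  | succ m ih =>
    have hlt : B.dim < x.dim := by
      rw [hdim]
      exact lt_mul_left hB.dim_pos (Nat.one_lt_two_pow (Nat.succ_ne_zero m))
    obtain ⟨c, κ₁', κ₂', hc, u₁, u₂, l₁, l₂, f₁, f₂⟩ := hB.exists_common_slot h₁ h₂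
      (List.ne_nil_of_length_eq_add_one len₁) (List.ne_nil_of_length_eq_add_one len₂) hlt
      (z := (-t₁) • x + t₂ • x) (by
        rw [← e₁, ← e₂, ← hx.ns.add_neg, QF.tw, QF.tw, smul_add, smul_smul, neg_mul_neg, one_mul]
        abel)
    obtain ⟨σ, p, r, hσ, hlen, hp, hr, g₁, g₂⟩ := ih (hB.tw hc)
      (by rw [hdim, dim_tw, pow_succ, mul_assoc]) u₁ u₂ (by omega) (by omega)
      (by rw [e₁, f₁, bt_tw, bt_cons]) (by rw [e₂, f₂, bt_tw, bt_cons])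
    exact ⟨c :: σ, p, r, unitList_cons.2 ⟨hc, hσ⟩, by simp [hlen], hp, hr,
      by rw [g₁, bt_tw, bt_cons], by rw [g₂, bt_tw, bt_cons]⟩

theorem bt_bt_congr {x : Cls F} {l₁ l₂ l₁' l₂' : List F} (h₁ : bt l₁ x = bt l₁' x)
    (h₂ : bt l₂ x = bt l₂' x) : bt l₁ (bt l₂ x) = bt l₁' (bt l₂' x) := by
  rw [h₂, bt_comm, h₁, bt_comm]

/-- `x` is a Pfister multiple of `B` with `n` further slots. -/
def IsMult (n : ℕ) (B x : Cls F) : Prop := ∃ κ, UnitList κ ∧ κ.length = n ∧ x = bt κ B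

/-- Some slot of a presentation of `bt l x` makes `x` a Pfister multiple of `B` with `n + 1`
further slots. -/
def IsMultAfter (n : ℕ) (B x : Cls F) (l : List F) : Prop :=
  ∃ t l', t ≠ 0 ∧ UnitList l' ∧ bt l x = bt (t :: l') x ∧ IsMult (n + 1) B (tw t x)

/-- Replacing the common factor of a pair by a multiple of `B`. -/
theorem Pf.exists_move {n : ℕ} {B x : Cls F} (hB : Pf B) (hx : Pf x)
    (hdim : x.dim = 2 ^ n * B.dim) {l₁ l₂ : List F} (u₁ : UnitList l₁) (u₂ : UnitList l₂)
    (h₁ : IsMult n B x ∨ IsMultAfter n B x l₁) (h₂ : IsMult n B x ∨ IsMultAfter n B x l₂) :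
    ∃ σ m₁ m₂, UnitList σ ∧ σ.length = n ∧ UnitList m₁ ∧ UnitList m₂ ∧
      QF.bt l₁ x = QF.bt m₁ (QF.bt σ B) ∧ QF.bt l₂ x = QF.bt m₂ (QF.bt σ B) ∧
      QF.bt l₁ (QF.bt l₂ x) = QF.bt m₁ (QF.bt m₂ (QF.bt σ B)) := by
  by_cases h : IsMult n B x
  · obtain ⟨κ, hκ, hlen, rfl⟩ := h
    exact ⟨κ, l₁, l₂, hκ, hlen, u₁, u₂, rfl, rfl, rfl⟩
  obtain ⟨t₁, l₁', ht₁, v₁, e₁, κ₁, w₁, len₁, f₁⟩ := h₁.resolve_left h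
  obtain ⟨t₂, l₂', ht₂, v₂, e₂, κ₂, w₂, len₂, f₂⟩ := h₂.resolve_left h
  obtain ⟨σ, p, r, hσ, hlen, hp, hr, g₁, g₂⟩ :=
    hB.exists_linkage hx hdim w₁ w₂ len₁ len₂ f₁ f₂
  refine ⟨σ, p :: l₁', r :: l₂', hσ, hlen, unitList_cons.2 ⟨hp, v₁⟩, unitList_cons.2 ⟨hr, v₂⟩,
    ?_, ?_, ?_⟩
  · rw [e₁, bt_cons, bt_cons, ← bt_tw, ← bt_tw, g₁]
  · rw [e₂, bt_cons, bt_cons, ← bt_tw, ← bt_tw, g₂]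
  · rw [bt_bt_congr e₁ e₂]
    simp only [bt_cons, bt_tw]
    rw [← bt_tw, ← bt_tw, ← bt_tw, ← bt_tw, hx.tw_tw_eq (hB.bt hσ) ht₂ ht₁ hr hp g₂ g₁]
    simp only [bt_tw]

theorem Pf.isMult_or {n : ℕ} {A : Cls F} (hA : Pf A) {a : F} {l m l₁ l₁' : List F} (ha : a ≠ 0)
    (hl : UnitList l) (hm : UnitList m) (hlen : l.length = n + 1) (u₁ : UnitList l₁)
    (h : QF.bt l₁ (QF.bt l A) = QF.bt l₁' (QF.bt (a :: m) A)) :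
    IsMult n (QF.tw a A) (QF.bt l A) ∨ IsMultAfter n (QF.tw a A) (QF.bt l A) l₁ := by
  have hrep : Rep (bp l A + bp l₁ (QF.bt l A)) (-a) := by
    have : bp l A + bp l₁ (QF.bt l A) =
        (-a) • QF.bt m A + (bp m A + bp l₁' (QF.bt (a :: m) A)) := by
      refine add_right_cancel_of_ns hA.ns ?_
      rw [bt_eq_add_bp l₁, bt_eq_add_bp l₁'] at h
      calc bp l A + bp l₁ (QF.bt l A) + A = A + bp l A + bp l₁ (QF.bt l A) := by abel
        _ = QF.bt (a :: m) A + bp l₁' (QF.bt (a :: m) A) := by rw [← bt_eq_add_bp, h]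
        _ = A + bp m A + (-a) • QF.bt m A + bp l₁' (QF.bt (a :: m) A) := by
          rw [← bt_eq_add_bp m A]
          rfl
        _ = _ := by abel
    rw [this]
    exact rep_add.2 ⟨-a, 0, rep_smul.2 ⟨1, (hA.bt hm).rep_one, mul_one _⟩, rep_zero _, add_zero _⟩
  obtain ⟨s, t, hs, ht, hst⟩ := rep_add.1 hrep
  by_cases ht0 : t = 0
  · left
    rw [ht0, add_zero] at hst
    obtain ⟨κ, hκ, len, e⟩ := hA.exists_cons hl ha (hst ▸ hs)
    exact ⟨κ, hκ, by omega, by rw [e, bt_tw, bt_cons]⟩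
  · right
    obtain ⟨l', hl', -, e⟩ := (hA.bt hl).exists_cons u₁ (neg_ne_zero.2 ht0) (by rwa [neg_neg])
    obtain ⟨κ, hκ, len, e'⟩ := hA.exists_cons (unitList_cons.2 ⟨neg_ne_zero.2 ht0, hl⟩) ha
      (rep_add.2 ⟨s, t, hs, rep_smul.2 ⟨1, (hA.bt hl).rep_one, by ring⟩, hst⟩)
    refine ⟨-t, l', neg_ne_zero.2 ht0, hl', e, κ, hκ, ?_, ?_⟩
    · rw [List.length_cons] at len
      omega
    · rw [← bt_cons, e', bt_tw, bt_cons]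

/-- Well-definedness of the two-form invariant for common factors that are multiples of the same
Pfister class `A`. -/
theorem Pf.bt_bt_eq {n : ℕ} {A : Cls F} (hA : Pf A) {l l' l₁ l₂ l₁' l₂' : List F} (hl : UnitList l)
    (hl' : UnitList l') (len : l.length = n) (len' : l'.length = n) (u₁ : UnitList l₁)
    (u₂ : UnitList l₂) (h₁ : QF.bt l₁ (QF.bt l A) = QF.bt l₁' (QF.bt l' A))
    (h₂ : QF.bt l₂ (QF.bt l A) = QF.bt l₂' (QF.bt l' A)) :
    QF.bt l₁ (QF.bt l₂ (QF.bt l A)) = QF.bt l₁' (QF.bt l₂' (QF.bt l' A)) := by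
  induction n generalizing A l l' l₁ l₂ with
  | zero =>
    rw [List.length_eq_zero_iff] at len len'
    subst len len'
    exact bt_bt_congr h₁ h₂
  | succ n ih =>
    obtain ⟨a, m, rfl⟩ := List.exists_cons_of_length_eq_add_one len'
    obtain ⟨ha, hm⟩ := unitList_cons.1 hl'
    obtain ⟨σ, m₁, m₂, hσ, hσn, v₁, v₂, e₁, e₂, e₃⟩ := (hA.tw ha).exists_move (n := n) (hA.bt hl)
      (by rw [dim_bt, dim_tw, len, pow_succ, mul_assoc]) u₁ u₂
      (hA.isMult_or ha hl hm len u₁ h₁) (hA.isMult_or ha hl hm len u₂ h₂)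
    rw [bt_cons, ← bt_tw] at h₁ h₂ ⊢
    rw [e₃]
    exact ih (hA.tw ha) hσ hm hσn (by simpa using len') v₁ v₂ (e₁ ▸ h₁) (e₂ ▸ h₂)

end Twists

section BaseForms

variable {F : Type} [Field F]

theorem mul_self_rep_unit {c : F} (h : Rep (cls (unit F)) c) : ∃ a, c = a * a := by
  obtain ⟨v, rfl⟩ := rep_cls.1 h
  exact ⟨_, unitForm_apply v⟩

theorem pf_unit (h2 : (2 : F) ≠ 0) : Pf (cls (unit F)) := by
  refine ⟨ns_cls.2 fun v hv => ?_, rep_cls.2 ⟨fun _ => 1, (unitForm_apply _).trans (mul_one 1)⟩,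
    fun c hc h => ?_⟩
  · have h₁ : polar (unitForm F) v (fun _ => 1) = 0 := hv _
    have h₀ : ∀ w : Fin 1 → F, polar (unitForm F) w (fun _ => 1) = 2 * w 0 := fun w => by
      rw [QuadraticMap.polar, unitForm_apply, unitForm_apply, unitForm_apply, Pi.add_apply]
      ring
    have h₃ := (mul_eq_zero.1 ((h₀ v).symm.trans h₁)).resolve_left h2
    funext i
    rw [show i = (0 : Fin 1) from Subsingleton.elim (α := Fin 1) _ _]
    exact h₃
  · obtain ⟨a, rfl⟩ := mul_self_rep_unit h
    exact mul_self_smul (left_ne_zero_of_mul hc) _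

/-- The class of `[1,α]`. -/
def binCls (α : F) : Cls F := cls (binary α)

theorem dim_binCls (α : F) : (binCls α).dim = 2 := rfl

theorem rep_binCls {α c : F} :
    Rep (binCls α) c ↔ ∃ x y, x * x + x * y + α * (y * y) = c := by
  rw [binCls, rep_cls]
  constructor
  · rintro ⟨v, rfl⟩
    exact ⟨_, _, (binaryForm_apply α v).symm⟩
  · rintro ⟨x, y, rfl⟩
    exact ⟨![x, y], (binaryForm_apply α _).trans (by simp)⟩

theorem polarNondeg_binaryForm (h2 : (2 : F) = 0) (α : F) : PolarNondeg (binaryForm α) := by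
  intro v hv
  have h₀ := hv ![0, 1]
  have h₁ := hv ![1, 0]
  rw [polar, binaryForm_apply, binaryForm_apply, binaryForm_apply] at h₀ h₁
  simp at h₀ h₁
  funext i
  fin_cases i
  · change v 0 = 0
    linear_combination h₀ - α * v 1 * h2
  · change v 1 = 0
    linear_combination h₁ - v 0 * h2

/-- The linear map `Fin 2 → F` with the given matrix entries. -/
def linTwo (a b c d : F) : (Fin 2 → F) →ₗ[F] (Fin 2 → F) :=
  LinearMap.pi ![a • LinearMap.proj 0 + b • LinearMap.proj 1,
    c • LinearMap.proj 0 + d • LinearMap.proj 1]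

theorem linTwo_apply_zero (a b c d : F) (v : Fin 2 → F) :
    linTwo a b c d v 0 = a * v 0 + b * v 1 := rfl

theorem linTwo_apply_one (a b c d : F) (v : Fin 2 → F) :
    linTwo a b c d v 1 = c * v 0 + d * v 1 := rfl

theorem pf_binCls (h2 : (2 : F) = 0) (α : F) : Pf (binCls α) := by
  have hns : NS (binCls α) := ns_cls.2 (polarNondeg_binaryForm h2 α)
  refine ⟨hns, rep_binCls.2 ⟨1, 0, by ring⟩, fun c hc h => ?_⟩
  obtain ⟨x, y, rfl⟩ := rep_binCls.1 h
  have hns' := hns.smul hc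
  rw [binCls, ← cls_smul] at hns' ⊢
  rw [cls_eq_iff]
  have key : ∀ v, binaryForm α (linTwo x (-(α * y)) y (x + y) v) =
      (x * x + x * y + α * (y * y)) * binaryForm α v := fun v => by
    simp only [binaryForm_apply, linTwo_apply_zero, linTwo_apply_one]
    ring
  exact equivalent_of_linearMap (ns_cls.1 hns') rfl (linTwo x (-(α * y)) y (x + y)) key

theorem binCls_add (h2 : (2 : F) = 0) (α β : F) :
    binCls α + binCls β = hypCls F + binCls (α + β) := by
  have key : ∀ v w : Fin 2 → F, hypForm F (linTwo 0 1 0 β v + linTwo 0 1 1 β w) +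
      binaryForm (α + β) (linTwo 1 0 0 1 v + linTwo 1 0 0 0 w) =
        binaryForm α v + binaryForm β w := fun v w => by
    simp only [hypForm_apply, binaryForm_apply, Pi.add_apply, linTwo_apply_zero,
      linTwo_apply_one]
    linear_combination (v 0 * w 0 + v 1 * w 0 + β * v 1 * v 1 + β * v 1 * w 1) * h2
  let f : (Fin 2 → F) × (Fin 2 → F) →ₗ[F] (Fin 2 → F) × (Fin 2 → F) :=
    ((linTwo 0 1 0 β).coprod (linTwo 0 1 1 β)).prod ((linTwo 1 0 0 1).coprod (linTwo 1 0 0 0))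
  have e : QuadraticMap.Equivalent ((binaryForm α).prod (binaryForm β))
      ((hypForm F).prod (binaryForm (α + β))) :=
    equivalent_of_linearMap (polarNondeg_prod.2
      ⟨polarNondeg_binaryForm h2 α, polarNondeg_binaryForm h2 β⟩) rfl f fun v => key v.1 v.2
  exact cls_add_eq_cls_add (p := binary α) (q := binary β) (r := hyp F) (s := binary (α + β)) e

theorem binCls_add_self (h2 : (2 : F) = 0) (α : F) :
    binCls α + binCls α = hypCls F + hypCls F := by
  have h := (pf_binCls h2 α).ns.add_neg
  rw [show (-1 : F) = 1 by linear_combination -h2, one_smul] at h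
  rw [h]
  exact two_nsmul _

theorem binCls_add_sq_add (h2 : (2 : F) = 0) (α x : F) :
    binCls (α + (x * x + x)) = binCls α := by
  have key : ∀ v, binaryForm α (linTwo 1 x 0 1 v) = binaryForm (α + (x * x + x)) v := fun v => by
    simp only [binaryForm_apply, linTwo_apply_zero, linTwo_apply_one]
    linear_combination (x * v 0 * v 1) * h2
  exact cls_eq_iff.2 (equivalent_of_linearMap (polarNondeg_binaryForm h2 _) rfl
    (linTwo 1 x 0 1) key)

theorem tw_binCls (h2 : (2 : F) = 0) (α s : F) :
    tw s (binCls (α + s)) = tw s (binCls α) := by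
  by_cases hs : s = 0
  · rw [hs, add_zero]
  have hns : PolarNondeg (-s • binaryForm (α + s)) :=
    (ns_cls (q := -s • binary (α + s))).1 ((pf_binCls h2 _).ns.smul (neg_ne_zero.2 hs))
  have key : ∀ v w : Fin 2 → F, binaryForm α (v + linTwo 0 s 0 0 w) +
      -s * binaryForm α (linTwo 0 1 0 0 v + w) =
        binaryForm (α + s) v + -s * binaryForm (α + s) w := fun v w => by
    simp only [binaryForm_apply, Pi.add_apply, linTwo_apply_zero, linTwo_apply_one]
    linear_combination (v 0 * s * w 1 - w 0 * s * v 1 - s * v 1 * v 1 + s * s * w 1 * w 1) * h2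
  let f : (Fin 2 → F) × (Fin 2 → F) →ₗ[F] (Fin 2 → F) × (Fin 2 → F) :=
    (LinearMap.id.coprod (linTwo 0 s 0 0)).prod ((linTwo 0 1 0 0).coprod LinearMap.id)
  have e : QuadraticMap.Equivalent ((binaryForm (α + s)).prod (-s • binaryForm (α + s)))
      ((binaryForm α).prod (-s • binaryForm α)) :=
    equivalent_of_linearMap (polarNondeg_prod.2 ⟨polarNondeg_binaryForm h2 _, hns⟩) rfl f
      fun v => key v.1 v.2
  exact cls_add_eq_cls_add (p := binary (α + s)) (q := -s • binary (α + s)) (r := binary α)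
    (s := -s • binary α) e

/-- Two Pfister multiples of binary forms that agree are related by a slot change. -/
theorem exists_slot_of_bt_eq (h2 : (2 : F) = 0) {α β : F} {l l' : List F} (hl : UnitList l)
    (h : bt l (binCls α) = bt l' (binCls β)) :
    ∃ x s, Rep (bp l (binCls α)) s ∧ β = α + (x * x + x) + s := by
  have hneg : ∀ c : F, -c = c := fun c => by linear_combination -c * h2
  have hiso : Isot (binCls (α + β) + bp l (binCls α)) := by
    have : binCls (α + β) + bp l (binCls α) = hypCls F + bp l' (binCls β) := by
      refine hypCls_add_cancel ?_
      rw [← add_assoc, ← add_assoc, ← binCls_add h2, ← binCls_add_self h2 β,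
        add_comm (binCls α), add_assoc, ← bt_eq_add_bp, h, bt_eq_add_bp, add_assoc]
    rw [this]
    exact isot_hypCls.add_right _
  have key : (∃ x y, (x ≠ 0 ∨ y ≠ 0) ∧
      Rep (bp l (binCls α)) (x * x + x * y + (α + β) * (y * y))) ∨ Isot (bp l (binCls α)) := by
    rcases hiso.cases with ⟨c, hc, h₁, h₂⟩ | h' | h'
    · left
      obtain ⟨x, y, rfl⟩ := rep_binCls.1 h₁
      refine ⟨x, y, ?_, by rwa [hneg] at h₂⟩
      by_contra! h0
      exact hc (by rw [h0.1, h0.2]; ring)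
    · left
      obtain ⟨v, hv, h0⟩ := isot_cls.1 h'
      change (Fin 2 → F) at v
      refine ⟨v 0, v 1, ?_, ?_⟩
      · by_contra! h0'
        refine h0 (funext fun i => ?_)
        change Fin 2 at i
        fin_cases i
        · exact h0'.1
        · exact h0'.2
      · rw [← binaryForm_apply, show binaryForm (α + β) v = 0 from hv]
        exact rep_zero _
    · exact Or.inr h'
  rcases key with ⟨x, y, h0, hr⟩ | h'
  · by_cases hy : y = 0
    · have hx : x ≠ 0 := h0.resolve_right fun h => h hy
      refine ⟨α + β, (α + β) * (α + β), ?_, by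
        linear_combination -(α + (α + β) * (α + β)) * h2⟩
      have := hr.sq_mul ((α + β) * x⁻¹)
      convert this using 1
      rw [hy]
      field_simp
      ring
    · refine ⟨x * y⁻¹, _, hr.sq_mul y⁻¹, ?_⟩
      field_simp
      linear_combination -(y * y * α + x * x + x * y) * h2
  · exact ⟨0, α + β, h'.rep ((pf_binCls h2 α).ns_bp hl) _, by linear_combination -α * h2⟩

theorem exists_bt_binCls (h2 : (2 : F) = 0) {α β x s : F} {l : List F} (hl : UnitList l)
    (hs : Rep (bp l (binCls α)) s) (hβ : β = α + (x * x + x) + s) :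
    IsMult l.length (binCls β) (bt l (binCls α)) := by
  subst hβ
  by_cases hs0 : s = 0
  · exact ⟨l, hl, rfl, by rw [hs0, add_zero, binCls_add_sq_add h2]⟩
  have hneg : -s = s := by linear_combination -s * h2
  obtain ⟨m, hm, hlen, e⟩ := (pf_binCls h2 α).exists_cons hl hs0 (hneg.symm ▸ hs)
  refine ⟨s :: m, unitList_cons.2 ⟨hs0, hm⟩, hlen, ?_⟩
  rw [e, bt_cons, bt_cons, ← bt_tw, ← bt_tw, tw_binCls h2 (α + (x * x + x)),
    binCls_add_sq_add h2]

theorem bp_append (l₁ l : List F) (x : Cls F) : bp (l₁ ++ l) x = bp l x + bp l₁ (bt l x) := by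
  induction l₁ with
  | nil => exact (add_zero _).symm
  | cons γ m ih => rw [List.cons_append, bp_cons, ih, bp_cons, bt_append, add_assoc]

theorem isMult_binCls_or (h2 : (2 : F) = 0) {α β : F} {l m l₁ l₁' : List F} (hl : UnitList l)
    (u₁ : UnitList l₁) (h : bt l₁ (bt l (binCls α)) = bt l₁' (bt m (binCls β))) :
    IsMult l.length (binCls β) (bt l (binCls α)) ∨
      IsMultAfter l.length (binCls β) (bt l (binCls α)) l₁ := by
  rw [← bt_append, ← bt_append] at h
  obtain ⟨x, s, hs, hβ⟩ := exists_slot_of_bt_eq h2 (unitList_append u₁ hl) h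
  rw [bp_append] at hs
  obtain ⟨u, t, hu, ht, rfl⟩ := rep_add.1 hs
  have hA := pf_binCls h2 α
  by_cases ht0 : t = 0
  · rw [ht0, add_zero] at hβ
    exact Or.inl (exists_bt_binCls h2 hl hu hβ)
  · right
    obtain ⟨l', hl', -, e⟩ := (hA.bt hl).exists_cons u₁ (neg_ne_zero.2 ht0) (by rwa [neg_neg])
    exact ⟨-t, l', neg_ne_zero.2 ht0, hl', e,
      exists_bt_binCls h2 (unitList_cons.2 ⟨neg_ne_zero.2 ht0, hl⟩)
        (rep_add.2 ⟨u, t, hu, rep_smul.2 ⟨1, (hA.bt hl).rep_one, by ring⟩, rfl⟩) hβ⟩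

/-- Well-definedness of the two-form invariant in characteristic two. -/
theorem bt_bt_binCls_eq (h2 : (2 : F) = 0) {α β : F} {l l' l₁ l₂ l₁' l₂' : List F}
    (hl : UnitList l) (hl' : UnitList l') (len : l.length = l'.length) (u₁ : UnitList l₁)
    (u₂ : UnitList l₂) (h₁ : bt l₁ (bt l (binCls α)) = bt l₁' (bt l' (binCls β)))
    (h₂ : bt l₂ (bt l (binCls α)) = bt l₂' (bt l' (binCls β))) :
    bt l₁ (bt l₂ (bt l (binCls α))) = bt l₁' (bt l₂' (bt l' (binCls β))) := by
  obtain ⟨σ, m₁, m₂, hσ, hσn, v₁, v₂, e₁, e₂, e₃⟩ := (pf_binCls h2 β).exists_move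
    (n := l.length) ((pf_binCls h2 α).bt hl) (by rw [dim_bt, dim_binCls, dim_binCls]) u₁ u₂
    (isMult_binCls_or h2 hl u₁ h₁) (isMult_binCls_or h2 hl u₂ h₂)
  rw [e₃]
  exact (pf_binCls h2 β).bt_bt_eq hσ hl' hσn len.symm v₁ v₂ (e₁ ▸ h₁) (e₂ ▸ h₂)

end BaseForms

section Invariant

variable {F : Type} [Field F]

theorem two_eq_zero_of_ringChar (h : ringChar F = 2) : (2 : F) = 0 := by
  have := (ringChar.spec F 2).2 (h ▸ dvd_rfl)
  exact_mod_cast this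

/-- The two-form invariant is well defined up to isometry. -/
theorem IsPairInv.cls_eq {k : ℕ} {ψ₁ ψ₂ ψ₁' ψ₂' q q' : QF F} (h : IsPairInv k ψ₁ ψ₂ q)
    (h' : IsPairInv k ψ₁' ψ₂' q') (e₁ : cls ψ₁ = cls ψ₁') (e₂ : cls ψ₂ = cls ψ₂') :
    cls q = cls q' := by
  obtain ⟨π, l₁, l₂, hπ, u₁, u₂, i₁, i₂, i⟩ := h
  obtain ⟨π', l₁', l₂', hπ', u₁', u₂', i₁', i₂', i'⟩ := h'
  rw [← cls_eq_iff] at i₁ i₂ i i₁' i₂' i'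
  rw [cls_btensor] at i₁ i₂ i₁' i₂'
  rw [cls_btensor, cls_btensor] at i i'
  have h₁ := (i₁.trans e₁).trans i₁'.symm
  have h₂ := (i₂.trans e₂).trans i₂'.symm
  rw [i, i']
  rw [IsQPfister] at hπ hπ'
  split_ifs at hπ hπ' with hchar
  · obtain ⟨l, α, hl, hlen, hq⟩ := hπ
    obtain ⟨l', β, hl', hlen', hq'⟩ := hπ'
    rw [← cls_eq_iff, cls_btensor] at hq hq'
    rw [← hq, ← hq'] at h₁ h₂ ⊢
    exact bt_bt_binCls_eq (two_eq_zero_of_ringChar hchar) hl hl' (by omega) u₁ u₂ h₁ h₂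
  · obtain ⟨l, hl, hlen, hq⟩ := hπ
    obtain ⟨l', hl', hlen', hq'⟩ := hπ'
    rw [← cls_eq_iff, cls_btensor] at hq hq'
    rw [← hq, ← hq'] at h₁ h₂ ⊢
    exact (pf_unit (Ring.two_ne_zero hchar)).bt_bt_eq hl hl' hlen hlen' u₁ u₂ h₁ h₂

theorem IsInv.ne_nil {k : ℕ} {ψs : List (QF F)} {q : QF F} (h : IsInv k ψs q) : ψs ≠ [] := by
  cases h <;> simp

theorem IsInv.cls_eq {k : ℕ} {ψs : List (QF F)} {q q' : QF F} (h : IsInv k ψs q)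
    (h' : IsInv k ψs q') : cls q = cls q' := by
  induction h generalizing q' with
  | single ψ =>
    generalize hL : [ψ] = L at h'
    cases h' with
    | single ψ' => rw [List.singleton_inj.1 hL]
    | step h₁ _ =>
      have h₂ := congrArg List.length hL
      have h₃ := List.length_pos_iff.2 h₁.ne_nil
      rw [List.length_append, List.length_singleton, List.length_singleton] at h₂
      omega
  | @step ψs ψ r q h₁ hp ih =>
    generalize hL : ψs ++ [ψ] = L at h'
    cases h' with
    | single ψ' =>
      have h₂ := congrArg List.length hL
      have h₃ := List.length_pos_iff.2 h₁.ne_nil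
      rw [List.length_append, List.length_singleton, List.length_singleton] at h₂
      omega
    | step h₁' hp' =>
      obtain ⟨rfl, h₂⟩ := List.append_inj' hL rfl
      rw [List.singleton_inj] at h₂
      exact hp.cls_eq hp' (ih h₁') (congrArg cls h₂)

theorem IsInv.exists_eq_bt {k : ℕ} {ψs : List (QF F)} {q π : QF F} (h : IsInv k ψs q)
    (hπ : IsQPfister k π) (hψ : ∀ ψ ∈ ψs, ∃ l : List F, UnitList l ∧ (btensor l π).Equiv ψ) :
    ∃ l : List F, UnitList l ∧ (btensor l π).Equiv q := by
  induction h with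
  | single ψ => exact hψ ψ (List.mem_singleton_self ψ)
  | @step ψs ψ r q h₁ hp ih =>
    obtain ⟨l₁, u₁, e₁⟩ := ih fun ψ h => hψ ψ (List.mem_append_left _ h)
    obtain ⟨l₂, u₂, e₂⟩ := hψ ψ (by simp)
    refine ⟨l₁ ++ l₂, unitList_append u₁ u₂, cls_eq_iff.1 ?_⟩
    refine IsPairInv.cls_eq ⟨π, l₁, l₂, hπ, u₁, u₂, e₁, e₂, cls_eq_iff.1 ?_⟩ hp rfl rfl
    rw [cls_btensor, cls_btensor, cls_btensor, bt_append]

theorem exists_isInv {k : ℕ} {ψs : List (QF F)} {π : QF F} (hπ : IsQPfister k π)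
    (hψ : ∀ ψ ∈ ψs, ∃ l : List F, UnitList l ∧ (btensor l π).Equiv ψ) (h0 : ψs ≠ []) :
    ∃ q, IsInv k ψs q := by
  induction ψs using List.reverseRecOn with
  | nil => exact absurd rfl h0
  | append_singleton ψs ψ ih =>
    by_cases h : ψs = []
    · subst h
      exact ⟨ψ, .single ψ⟩
    have hψs : ∀ ψ ∈ ψs, ∃ l : List F, UnitList l ∧ (btensor l π).Equiv ψ :=
      fun ψ h => hψ ψ (List.mem_append_left _ h)
    obtain ⟨r, hr⟩ := ih hψs h
    obtain ⟨l₁, u₁, e₁⟩ := hr.exists_eq_bt hπ hψs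
    obtain ⟨l₂, u₂, e₂⟩ := hψ ψ (by simp)
    exact ⟨_, hr.step ⟨π, l₁, l₂, hπ, u₁, u₂, e₁, e₂, cls_eq_iff.1 rfl⟩⟩

theorem IsQPfister.btensor {k : ℕ} {π q : QF F} (hπ : IsQPfister k π) {l : List F}
    (hl : UnitList l) (h : (QF.btensor l π).Equiv q) : IsQPfister (l.length + k) q := by
  rw [IsQPfister] at hπ ⊢
  rw [← cls_eq_iff, cls_btensor] at h
  split_ifs at hπ ⊢ with hchar
  · obtain ⟨m, α, hm, hlen, e⟩ := hπ
    rw [← cls_eq_iff, cls_btensor] at e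
    exact ⟨l ++ m, α, unitList_append hl hm, by rw [List.length_append, add_assoc, hlen],
      cls_eq_iff.1 (by rw [cls_btensor, bt_append, e, h])⟩
  · obtain ⟨m, hm, hlen, e⟩ := hπ
    rw [← cls_eq_iff, cls_btensor] at e
    exact ⟨l ++ m, unitList_append hl hm, by rw [List.length_append, hlen],
      cls_eq_iff.1 (by rw [cls_btensor, bt_append, e, h])⟩

end Invariant

end QF

/-- Let `ψ₁,…,ψ_m` be quadratic Pfister forms that are all `k`-linked.
Then the partial invariant `F^{m−1}_k(ψ₁,…,ψ_{m−1})` is a quadratic Pfister form that is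
`k`-linked to `ψ_m` (so the inductive definition
`F^m_k(ψ₁,…,ψ_m) = F²_k(F^{m−1}_k(ψ₁,…,ψ_{m−1}), ψ_m)` makes sense), the invariant
`F^m_k(ψ₁,…,ψ_m)` exists, and it is well defined up to isometry, independent of all
choices. -/
theorem multi_invariant_well_defined
    (F : Type) [Field F] (k : ℕ)
    (ψs : List (QF F)) (hlen : 2 ≤ ψs.length)
    (hlinked : QF.SepLinked k ψs) :
    (∀ ψm, ψs.getLast? = some ψm → ∀ q, QF.IsInv k ψs.dropLast q →
        (∃ n, QF.IsQPfister n q) ∧ QF.SepLinked k [q, ψm]) ∧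
      (∃ q, QF.IsInv k ψs q) ∧
      (∀ q q', QF.IsInv k ψs q → QF.IsInv k ψs q' → q.Equiv q') := by
  obtain ⟨π, hπ, hψ⟩ := hlinked
  have h0 : ψs ≠ [] := by
    rintro rfl
    simp at hlen
  refine ⟨fun ψm hm q hq => ?_, QF.exists_isInv hπ hψ h0, fun q q' h h' =>
    QF.cls_eq_iff.1 (h.cls_eq h')⟩
  obtain ⟨l, hl, e⟩ := hq.exists_eq_bt hπ fun ψ h => hψ ψ (List.dropLast_subset _ h)
  refine ⟨⟨_, hπ.btensor hl e⟩, π, hπ, fun ψ h => ?_⟩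
  rw [List.mem_cons, List.mem_singleton] at h
  rcases h with rfl | rfl
  · exact ⟨l, hl, e⟩
  · exact hψ ψ (List.mem_of_getLast? hm)
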